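/- Let R be a definably connected definable semiprime ring. Then either R is a division ring, or there is a finite set {e₁, …, e_n} of primitive idempotents of R such that R = R·e₁ ⊕ ⋯ ⊕ R·e_n (an internal direct sum of additive subgroups) and each R·eᵢ is a minimal left ideal of R. -/

import Mathlib

open FirstOrder

namespace OMin

variable (L : FirstOrder.Language) (M : Type) [L.Structure M]

/-- A set of tuples from `M` is *definable* (with arbitrary parameters from `M`). -/
def Defin {α : Type} (s : Set (α → M)) : Prop :=
  Set.Definable (Set.univ : Set M) L s

section Order

variable [LinearOrder M]

/-- A subset of `M` that is a single point or an open interval. -/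
def IsPointOrInterval (s : Set M) : Prop :=
  (∃ a, s = {a}) ∨ (∃ a b, s = Set.Ioo a b) ∨ (∃ a, s = Set.Ioi a) ∨
    (∃ a, s = Set.Iio a) ∨ s = Set.univ

/-- `M` (with the structure of `L` and the order `<`) is an o-minimal structure:
a structure on a dense linear order without endpoints, whose order is definable,
such that every definable subset of `M` is a finite union of points and open intervals. -/
def OMinimal : Prop :=
  DenselyOrdered M ∧ NoMinOrder M ∧ NoMaxOrder M ∧ Nonempty M ∧
    Defin L M {x : Fin 2 → M | x 0 < x 1} ∧
    ∀ s : Set M, Defin L M {x : Fin 1 → M | x 0 ∈ s} →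
      ∃ (n : ℕ) (t : Fin n → Set M), (∀ i, IsPointOrInterval M (t i)) ∧ s = ⋃ i, t i

/-- The order topology on `M`. -/
def otop : TopologicalSpace M := Preorder.topology M

/-- The product of the order topology on tuples. -/
def ptop (k : ℕ) : TopologicalSpace (Fin k → M) :=
  @Pi.topologicalSpace (Fin k) (fun _ => M) (fun _ => otop M)

/-- A definable set `S` is definably connected iff it is not the union of two disjoint
nonempty definable subsets that are open in `S`. -/
def DefConnected {k : ℕ} (S : Set (Fin k → M)) : Prop :=
  ∀ U V : Set (Fin k → M), Defin L M U → Defin L M V →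
    (∃ U', @IsOpen _ (ptop M k) U' ∧ U = U' ∩ S) →
    (∃ V', @IsOpen _ (ptop M k) V' ∧ V = V' ∩ S) →
    U ∪ V = S → U ∩ V = ∅ → (U = ∅ ∨ V = ∅)

/-- `X ⊆ M^k` has dimension at least `n`: some coordinate projection to `M^n` of `X`
has nonempty interior. -/
def DimGE {k : ℕ} (X : Set (Fin k → M)) (n : ℕ) : Prop :=
  ∃ f : Fin n → Fin k, Function.Injective f ∧
    (@interior _ (ptop M n) ((fun x : Fin k → M => x ∘ f) '' X)).Nonempty

/-- `X` has dimension exactly `n`: `n` is the largest integer such that the image of `X`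
under some coordinate projection `M^k → M^n` has nonempty interior. -/
def DimEq {k : ℕ} (X : Set (Fin k → M)) (n : ℕ) : Prop :=
  DimGE M X n ∧ ∀ m : ℕ, DimGE M X m → m ≤ n

end Order

/-- A definable abelian group: a definable set with definable group operations. -/
structure DefAbGroup where
  k : ℕ
  carrier : Set (Fin k → M)
  zero : Fin k → M
  add : (Fin k → M) → (Fin k → M) → (Fin k → M)
  neg : (Fin k → M) → (Fin k → M)
  zero_mem : zero ∈ carrier
  add_mem : ∀ x ∈ carrier, ∀ y ∈ carrier, add x y ∈ carrier
  neg_mem : ∀ x ∈ carrier, neg x ∈ carrier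
  hadd_assoc : ∀ x ∈ carrier, ∀ y ∈ carrier, ∀ z ∈ carrier,
    add (add x y) z = add x (add y z)
  hadd_comm : ∀ x ∈ carrier, ∀ y ∈ carrier, add x y = add y x
  hzero_add : ∀ x ∈ carrier, add zero x = x
  hneg_add : ∀ x ∈ carrier, add (neg x) x = zero
  carrier_def : Defin L M carrier
  add_def : Defin L M {p : (Fin k ⊕ Fin k ⊕ Fin k) → M |
    (fun i => p (Sum.inl i)) ∈ carrier ∧ (fun i => p (Sum.inr (Sum.inl i))) ∈ carrier ∧
    add (fun i => p (Sum.inl i)) (fun i => p (Sum.inr (Sum.inl i))) =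
      fun i => p (Sum.inr (Sum.inr i))}
  neg_def : Defin L M {p : (Fin k ⊕ Fin k) → M |
    (fun i => p (Sum.inl i)) ∈ carrier ∧
    neg (fun i => p (Sum.inl i)) = fun i => p (Sum.inr i)}

/-- A definable (not necessarily unital or commutative) ring: a definable abelian group
together with a definable associative multiplication distributing over the addition. -/
structure DefRing extends DefAbGroup L M where
  mul : (Fin k → M) → (Fin k → M) → (Fin k → M)
  mul_mem : ∀ x ∈ carrier, ∀ y ∈ carrier, mul x y ∈ carrier
  hmul_assoc : ∀ x ∈ carrier, ∀ y ∈ carrier, ∀ z ∈ carrier,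
    mul (mul x y) z = mul x (mul y z)
  hleft_distrib : ∀ x ∈ carrier, ∀ y ∈ carrier, ∀ z ∈ carrier,
    mul x (add y z) = add (mul x y) (mul x z)
  hright_distrib : ∀ x ∈ carrier, ∀ y ∈ carrier, ∀ z ∈ carrier,
    mul (add x y) z = add (mul x z) (mul y z)
  mul_def : Defin L M {p : (Fin k ⊕ Fin k ⊕ Fin k) → M |
    (fun i => p (Sum.inl i)) ∈ carrier ∧ (fun i => p (Sum.inr (Sum.inl i))) ∈ carrier ∧
    mul (fun i => p (Sum.inl i)) (fun i => p (Sum.inr (Sum.inl i))) =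
      fun i => p (Sum.inr (Sum.inr i))}

end OMin
namespace OMin

namespace DefAbGroup

variable {L : FirstOrder.Language} {M : Type} [L.Structure M] (G : DefAbGroup L M)

/-- `n • x` in the group `G`. -/
def nsmul : ℕ → (Fin G.k → M) → (Fin G.k → M)
  | 0, _ => G.zero
  | n + 1, x => G.add x (nsmul n x)

/-- Sum of a list of elements. -/
def listSum : List (Fin G.k → M) → (Fin G.k → M)
  | [] => G.zero
  | x :: l => G.add x (listSum l)

/-- Sum of a finitely indexed family of elements. -/
noncomputable def univSum {ι : Type} [Fintype ι] (f : ι → (Fin G.k → M)) : Fin G.k → M :=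
  G.listSum ((Finset.univ : Finset ι).toList.map f)

/-- `S` is a subgroup of `G`. -/
def IsSubgroup (S : Set (Fin G.k → M)) : Prop :=
  S ⊆ G.carrier ∧ G.zero ∈ S ∧ (∀ x ∈ S, ∀ y ∈ S, G.add x y ∈ S) ∧ ∀ x ∈ S, G.neg x ∈ S

/-- The `n`-torsion subgroup `{x : n • x = 0}`. -/
def torsion (n : ℕ) : Set (Fin G.k → M) :=
  {x | x ∈ G.carrier ∧ G.nsmul n x = G.zero}

/-- The elements of `S` have no (nontrivial) torsion. -/
def TorsionFreeOn (S : Set (Fin G.k → M)) : Prop :=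
  ∀ x ∈ S, ∀ n : ℕ, G.nsmul (n + 1) x = G.zero → x = G.zero

/-- The group `G` is torsion-free. -/
def TorsionFree : Prop := G.TorsionFreeOn G.carrier

/-- The set `S` is the internal direct sum of the family `I` of subgroups of `G`:
every element of `S` is uniquely the sum of a family of elements of the `I i`. -/
def IsInternalDirectSumOn {ι : Type} [Fintype ι] (S : Set (Fin G.k → M))
    (I : ι → Set (Fin G.k → M)) : Prop :=
  (∀ i, G.IsSubgroup (I i) ∧ I i ⊆ S) ∧
  (∀ x ∈ S, ∃ f : ι → (Fin G.k → M), (∀ i, f i ∈ I i) ∧ G.univSum f = x) ∧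
  (∀ f g : ι → (Fin G.k → M), (∀ i, f i ∈ I i) → (∀ i, g i ∈ I i) →
    G.univSum f = G.univSum g → f = g)

/-- `G` is the internal direct sum of the family `I` of subgroups. -/
def IsInternalDirectSum {ι : Type} [Fintype ι] (I : ι → Set (Fin G.k → M)) : Prop :=
  G.IsInternalDirectSumOn G.carrier I

section Order

variable [LinearOrder M]

/-- `C` is the definably connected component of `0` in `G`, i.e. the largest
definably connected definable subgroup of `G`. -/
def IsZeroComponent (C : Set (Fin G.k → M)) : Prop :=
  G.IsSubgroup C ∧ Defin L M C ∧ DefConnected L M C ∧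
    ∀ D, G.IsSubgroup D → Defin L M D → DefConnected L M D → D ⊆ C

/-- `N` is the maximal definable torsion-free subgroup of `G`. -/
def IsMaxDefTorsionFree (N : Set (Fin G.k → M)) : Prop :=
  G.IsSubgroup N ∧ Defin L M N ∧ G.TorsionFreeOn N ∧
    ∀ D, G.IsSubgroup D → Defin L M D → G.TorsionFreeOn D → D ⊆ N

end Order

end DefAbGroup

namespace DefRing

variable {L : FirstOrder.Language} {M : Type} [L.Structure M] (R : DefRing L M)

/-- `R` is a null ring: all products vanish. -/
def IsNull : Prop := ∀ x ∈ R.carrier, ∀ y ∈ R.carrier, R.mul x y = R.zero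

/-- The multiplication of `R` restricted to `S` is trivial. -/
def NullOn (S : Set (Fin R.k → M)) : Prop := ∀ x ∈ S, ∀ y ∈ S, R.mul x y = R.zero

/-- The two-sided annihilator of `X` in `R`. -/
def annOf (X : Set (Fin R.k → M)) : Set (Fin R.k → M) :=
  {a | a ∈ R.carrier ∧ ∀ x ∈ X, R.mul a x = R.zero ∧ R.mul x a = R.zero}

/-- `Ann(R)`, the two-sided annihilator of `R`. -/
def ann : Set (Fin R.k → M) := R.annOf R.carrier

/-- `powSucc x n = x^(n+1)`. -/
def powSucc (x : Fin R.k → M) : ℕ → (Fin R.k → M)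
  | 0 => x
  | n + 1 => R.mul (powSucc x n) x

/-- `upow e x n = x^n`, where `x^0 = e` (for a unital ring with identity `e`). -/
def upow (e x : Fin R.k → M) : ℕ → (Fin R.k → M)
  | 0 => e
  | n + 1 => R.mul (upow e x n) x

/-- `products S n` is the set of all products of `n` elements of `S` (for `n ≥ 1`;
by convention `products S 0 = {0}`). -/
def products (S : Set (Fin R.k → M)) : ℕ → Set (Fin R.k → M)
  | 0 => {R.zero}
  | 1 => S
  | n + 2 => {z | ∃ x ∈ S, ∃ y ∈ products S (n + 1), z = R.mul x y}

/-- `R` is a nilpotent ring: all products of some fixed length vanish. -/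
def IsNilpotentRing : Prop := ∃ m, 1 ≤ m ∧ R.products R.carrier m = {R.zero}

/-- `R` is a nil ring: every element is nilpotent. -/
def IsNilRing : Prop := ∀ x ∈ R.carrier, ∃ m : ℕ, R.powSucc x m = R.zero

/-- The set `I` is nilpotent: all products of some fixed length of elements of `I` vanish. -/
def NilpotentSet (I : Set (Fin R.k → M)) : Prop := ∃ m, 1 ≤ m ∧ R.products I m = {R.zero}

/-- `I` is a left ideal of `R`. -/
def IsLeftIdeal (I : Set (Fin R.k → M)) : Prop :=
  R.IsSubgroup I ∧ ∀ r ∈ R.carrier, ∀ x ∈ I, R.mul r x ∈ I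

/-- `I` is a right ideal of `R`. -/
def IsRightIdeal (I : Set (Fin R.k → M)) : Prop :=
  R.IsSubgroup I ∧ ∀ r ∈ R.carrier, ∀ x ∈ I, R.mul x r ∈ I

/-- `I` is a two-sided ideal of `R`. -/
def IsIdeal (I : Set (Fin R.k → M)) : Prop :=
  R.IsSubgroup I ∧ ∀ r ∈ R.carrier, ∀ x ∈ I, R.mul r x ∈ I ∧ R.mul x r ∈ I

/-- The Jacobson radical of `R`:
`J(R) = {a ∈ R : ∀ r ∈ R, ∃ b ∈ R, b·r·a − r·a − b = 0}`. -/
def jacobson : Set (Fin R.k → M) :=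
  {a | a ∈ R.carrier ∧ ∀ r ∈ R.carrier, ∃ b ∈ R.carrier,
    R.add (R.mul (R.mul b r) a) (R.add (R.neg (R.mul r a)) (R.neg b)) = R.zero}

/-- `R` is semiprime: `{0}` is its only nilpotent two-sided ideal. -/
def IsSemiprime : Prop := ∀ I, R.IsIdeal I → R.NilpotentSet I → I = {R.zero}

/-- `R` is prime: `aRb ≠ {0}` whenever `a, b ≠ 0`. -/
def IsPrimeRing : Prop := ∀ a ∈ R.carrier, a ≠ R.zero → ∀ b ∈ R.carrier, b ≠ R.zero →
    ∃ r ∈ R.carrier, R.mul (R.mul a r) b ≠ R.zero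

/-- `R` is simple: nontrivial multiplication and no nontrivial proper two-sided ideals. -/
def IsSimple : Prop := (¬ R.IsNull) ∧ ∀ I, R.IsIdeal I → I = {R.zero} ∨ I = R.carrier

/-- `R` is definably simple: nontrivial multiplication and no nontrivial proper
*definable* two-sided ideals. -/
def IsDefSimple : Prop :=
  (¬ R.IsNull) ∧ ∀ I, R.IsIdeal I → Defin L M I → I = {R.zero} ∨ I = R.carrier

/-- `e` is a (two-sided) multiplicative identity of `R`. -/
def IsIdentity (e : Fin R.k → M) : Prop :=
  e ∈ R.carrier ∧ ∀ x ∈ R.carrier, R.mul e x = x ∧ R.mul x e = x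

/-- `R` is unital. -/
def IsUnital : Prop := ∃ e, R.IsIdentity e

/-- `R` is a division ring. -/
def IsDivisionRing : Prop :=
  ∃ e, R.IsIdentity e ∧ e ≠ R.zero ∧ ∀ x ∈ R.carrier, x ≠ R.zero →
    ∃ y ∈ R.carrier, R.mul x y = e ∧ R.mul y x = e

theorem IsDivisionRing.unital {R : DefRing L M} (h : R.IsDivisionRing) : R.IsUnital :=
  h.imp fun _ he => he.1

/-- `S` is a subring (as a subset, not necessarily definable). -/
def IsSubringSet (S : Set (Fin R.k → M)) : Prop :=
  S ⊆ R.carrier ∧ R.zero ∈ S ∧ (∀ x ∈ S, ∀ y ∈ S, R.add x y ∈ S) ∧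
    (∀ x ∈ S, R.neg x ∈ S) ∧ ∀ x ∈ S, ∀ y ∈ S, R.mul x y ∈ S

/-- `S` is a definable subring of `R`. -/
def IsDefSubring (S : Set (Fin R.k → M)) : Prop :=
  Defin L M S ∧ R.IsSubringSet S

/-- `S` is the smallest definable subring of `R` containing `x`. -/
def IsSmallestDefSubringContaining (x : Fin R.k → M) (S : Set (Fin R.k → M)) : Prop :=
  R.IsDefSubring S ∧ x ∈ S ∧ ∀ T, R.IsDefSubring T → x ∈ T → S ⊆ T

/-- `e` is an idempotent element of `R`. -/
def IsIdempotent (e : Fin R.k → M) : Prop := e ∈ R.carrier ∧ R.mul e e = e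

/-- `a` and `b` are orthogonal: `a·b = b·a = 0`. -/
def Orthogonal (a b : Fin R.k → M) : Prop := R.mul a b = R.zero ∧ R.mul b a = R.zero

/-- `e` is a primitive idempotent: a nonzero idempotent that is not the sum of two
nonzero orthogonal idempotents. -/
def IsPrimitiveIdempotent (e : Fin R.k → M) : Prop :=
  R.IsIdempotent e ∧ e ≠ R.zero ∧
    ¬ ∃ a b, R.IsIdempotent a ∧ R.IsIdempotent b ∧ a ≠ R.zero ∧ b ≠ R.zero ∧
      R.Orthogonal a b ∧ R.add a b = e

/-- The set `R·e`. -/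
def leftMulSet (e : Fin R.k → M) : Set (Fin R.k → M) :=
  {z | ∃ r ∈ R.carrier, z = R.mul r e}

/-- The set `e·R`. -/
def rightMulSet (e : Fin R.k → M) : Set (Fin R.k → M) :=
  {z | ∃ r ∈ R.carrier, z = R.mul e r}

/-- The set `e·R·f`. -/
def midMulSet (e f : Fin R.k → M) : Set (Fin R.k → M) :=
  {z | ∃ r ∈ R.carrier, z = R.mul e (R.mul r f)}

/-- `I` is a minimal left ideal. -/
def IsMinimalLeftIdeal (I : Set (Fin R.k → M)) : Prop :=
  R.IsLeftIdeal I ∧ I ≠ {R.zero} ∧ ∀ J, R.IsLeftIdeal J → J ⊆ I → J = {R.zero} ∨ J = I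

/-- `I` is a minimal right ideal. -/
def IsMinimalRightIdeal (I : Set (Fin R.k → M)) : Prop :=
  R.IsRightIdeal I ∧ I ≠ {R.zero} ∧ ∀ J, R.IsRightIdeal J → J ⊆ I → J = {R.zero} ∨ J = I

/-- `R` is left Artinian: every descending chain of left ideals stabilizes. -/
def LeftArtinian : Prop :=
  ∀ f : ℕ → Set (Fin R.k → M), (∀ n, R.IsLeftIdeal (f n)) → (∀ n, f (n + 1) ⊆ f n) →
    ∃ N, ∀ n, N ≤ n → f n = f N

/-- `J` is a two-sided ideal of the (sub)ring `S`. -/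
def IsIdealOn (S J : Set (Fin R.k → M)) : Prop :=
  J ⊆ S ∧ R.zero ∈ J ∧ (∀ x ∈ J, ∀ y ∈ J, R.add x y ∈ J) ∧ (∀ x ∈ J, R.neg x ∈ J) ∧
    ∀ r ∈ S, ∀ x ∈ J, R.mul r x ∈ J ∧ R.mul x r ∈ J

/-- The (sub)ring `S` is a simple ring. -/
def SimpleOn (S : Set (Fin R.k → M)) : Prop :=
  (¬ R.NullOn S) ∧ ∀ J, R.IsIdealOn S J → J = {R.zero} ∨ J = S

/-- The (sub)ring `S` is a division ring. -/
def DivisionOn (S : Set (Fin R.k → M)) : Prop :=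
  ∃ e ∈ S, e ≠ R.zero ∧ (∀ x ∈ S, R.mul e x = x ∧ R.mul x e = x) ∧
    ∀ x ∈ S, x ≠ R.zero → ∃ y ∈ S, R.mul x y = e ∧ R.mul y x = e

/-- `R` is a (commutative) field. -/
def IsFieldRing : Prop :=
  (∀ x ∈ R.carrier, ∀ y ∈ R.carrier, R.mul x y = R.mul y x) ∧
  ∃ e, R.IsIdentity e ∧ e ≠ R.zero ∧
    ∀ x ∈ R.carrier, x ≠ R.zero → ∃ y ∈ R.carrier, R.mul x y = e

/-- Evaluation of the polynomial `∑_{i ≤ n} c i * X^i` at `x` (`e` the identity). -/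
def polyEval (e x : Fin R.k → M) (c : ℕ → (Fin R.k → M)) (n : ℕ) : Fin R.k → M :=
  R.listSum ((List.range (n + 1)).map fun i => R.mul (c i) (R.upow e x i))

/-- `R` is a real closed field: a field together with a linear order making it an
ordered field in which nonnegative elements are squares and every odd-degree polynomial
has a root. -/
def IsRealClosedDefField : Prop :=
  R.IsFieldRing ∧
  ∃ e, R.IsIdentity e ∧
  ∃ lt : (Fin R.k → M) → (Fin R.k → M) → Prop,
    (∀ x ∈ R.carrier, ¬ lt x x) ∧
    (∀ x ∈ R.carrier, ∀ y ∈ R.carrier, ∀ z ∈ R.carrier, lt x y → lt y z → lt x z) ∧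
    (∀ x ∈ R.carrier, ∀ y ∈ R.carrier, x ≠ y → lt x y ∨ lt y x) ∧
    (∀ x ∈ R.carrier, ∀ y ∈ R.carrier, ∀ z ∈ R.carrier, lt x y →
      lt (R.add x z) (R.add y z)) ∧
    (∀ x ∈ R.carrier, ∀ y ∈ R.carrier, lt R.zero x → lt R.zero y → lt R.zero (R.mul x y)) ∧
    (∀ x ∈ R.carrier, ¬ lt x R.zero → ∃ y ∈ R.carrier, R.mul y y = x) ∧
    (∀ n : ℕ, Odd n → ∀ c : ℕ → (Fin R.k → M), (∀ i, i ≤ n → c i ∈ R.carrier) →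
      c n ≠ R.zero → ∃ x ∈ R.carrier, R.polyEval e x c n = R.zero)

end DefRing

/-- A definable isomorphism of definable rings: a ring isomorphism whose graph is
definable. -/
def DefIso {L : FirstOrder.Language} {M : Type} [L.Structure M] (A B : DefRing L M) : Prop :=
  ∃ f : (Fin A.k → M) → (Fin B.k → M),
    Set.BijOn f A.carrier B.carrier ∧
    (∀ x ∈ A.carrier, ∀ y ∈ A.carrier,
      f (A.add x y) = B.add (f x) (f y) ∧ f (A.mul x y) = B.mul (f x) (f y)) ∧
    Defin L M {p : (Fin A.k ⊕ Fin B.k) → M |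
      (fun i => p (Sum.inl i)) ∈ A.carrier ∧
      f (fun i => p (Sum.inl i)) = fun i => p (Sum.inr i)}

end OMin
namespace OMin

/-- The language of rings with only the two binary operations `+` and `·`. -/
def ringLang : FirstOrder.Language :=
  ⟨fun n => match n with | 2 => Bool | _ => Empty, fun _ => Empty⟩

namespace DefRing

variable {L : FirstOrder.Language} {M : Type} [L.Structure M] (R : DefRing L M)

/-- The ring structure `(R, +, ·)` as a first-order structure on the carrier of `R`. -/
def innerStr : ringLang.Structure ↥R.carrier where
  funMap {n} f x :=
    match n, f, x with
    | 2, b, x =>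
      if (show Bool from b) then ⟨R.add ↑(x 0) ↑(x 1), R.add_mem _ (x 0).2 _ (x 1).2⟩
      else ⟨R.mul ↑(x 0) ↑(x 1), R.mul_mem _ (x 0).2 _ (x 1).2⟩
    | 0, f, _ => f.elim
    | 1, f, _ => f.elim
    | _ + 3, f, _ => f.elim
  RelMap {n} r _ := r.elim

/-- A set of tuples from the carrier of `R` that is definable in the pure ring
structure `(R, +, ·)`. -/
def InnerDefinable {α : Type} (S : Set (α → ↥R.carrier)) : Prop :=
  letI := R.innerStr
  Set.Definable (Set.univ : Set ↥R.carrier) ringLang S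

/-- A subset of `R` that is definable in the pure ring structure `(R, +, ·)`. -/
def InnerDefinableSubset (S : Set (Fin R.k → M)) : Prop :=
  S ⊆ R.carrier ∧
    R.InnerDefinable {x : Fin 1 → ↥R.carrier | ((x 0 : ↥R.carrier) : Fin R.k → M) ∈ S}

variable {R}

theorem add_zero' {x : Fin R.k → M} (hx : x ∈ R.carrier) : R.add x R.zero = x := by
  rw [R.hadd_comm x hx R.zero R.zero_mem]; exact R.hzero_add x hx

theorem add_neg' {x : Fin R.k → M} (hx : x ∈ R.carrier) : R.add x (R.neg x) = R.zero := by
  rw [R.hadd_comm x hx (R.neg x) (R.neg_mem x hx)]; exact R.hneg_add x hx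

theorem add_left_cancel' {a b c : Fin R.k → M}
    (ha : a ∈ R.carrier) (hb : b ∈ R.carrier) (hc : c ∈ R.carrier)
    (h : R.add a b = R.add a c) : b = c := by
  have hna := R.neg_mem a ha
  calc b = R.add R.zero b := (R.hzero_add b hb).symm
    _ = R.add (R.add (R.neg a) a) b := by rw [R.hneg_add a ha]
    _ = R.add (R.neg a) (R.add a b) := R.hadd_assoc _ hna _ ha _ hb
    _ = R.add (R.neg a) (R.add a c) := by rw [h]
    _ = R.add (R.add (R.neg a) a) c := (R.hadd_assoc _ hna _ ha _ hc).symm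
    _ = R.add R.zero c := by rw [R.hneg_add a ha]
    _ = c := R.hzero_add c hc

theorem zero_mul' {x : Fin R.k → M} (hx : x ∈ R.carrier) : R.mul R.zero x = R.zero := by
  have h0 := R.zero_mem
  have hm := R.mul_mem _ h0 _ hx
  apply add_left_cancel' hm hm h0
  calc R.add (R.mul R.zero x) (R.mul R.zero x)
      = R.mul (R.add R.zero R.zero) x := (R.hright_distrib _ h0 _ h0 _ hx).symm
    _ = R.mul R.zero x := by rw [R.hzero_add _ h0]
    _ = R.add (R.mul R.zero x) R.zero := (add_zero' hm).symm

theorem mul_zero' {x : Fin R.k → M} (hx : x ∈ R.carrier) : R.mul x R.zero = R.zero := by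
  have h0 := R.zero_mem
  have hm := R.mul_mem _ hx _ h0
  apply add_left_cancel' hm hm h0
  calc R.add (R.mul x R.zero) (R.mul x R.zero)
      = R.mul x (R.add R.zero R.zero) := (R.hleft_distrib _ hx _ h0 _ h0).symm
    _ = R.mul x R.zero := by rw [R.hzero_add _ h0]
    _ = R.add (R.mul x R.zero) R.zero := (add_zero' hm).symm

variable (R)

/-- The addition on the carrier of a definable ring. -/
def addSub : Add ↥R.carrier := ⟨fun a b => ⟨R.add a b, R.add_mem _ a.2 _ b.2⟩⟩

/-- The zero of the carrier of a definable ring. -/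
def zeroSub : Zero ↥R.carrier := ⟨⟨R.zero, R.zero_mem⟩⟩

/-- The negation on the carrier of a definable ring. -/
def negSub : Neg ↥R.carrier := ⟨fun a => ⟨R.neg a, R.neg_mem _ a.2⟩⟩

/-- The unital ring structure on the carrier of a unital definable ring. -/
noncomputable def ringSub (h : R.IsUnital) : Ring ↥R.carrier := by
  letI := R.addSub; letI := R.zeroSub; letI := R.negSub
  exact
  { add := fun a b => ⟨R.add a b, R.add_mem _ a.2 _ b.2⟩
    add_assoc := fun a b c => Subtype.ext (R.hadd_assoc _ a.2 _ b.2 _ c.2)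
    zero := ⟨R.zero, R.zero_mem⟩
    zero_add := fun a => Subtype.ext (R.hzero_add _ a.2)
    add_zero := fun a => Subtype.ext (add_zero' a.2)
    add_comm := fun a b => Subtype.ext (R.hadd_comm _ a.2 _ b.2)
    neg := fun a => ⟨R.neg a, R.neg_mem _ a.2⟩
    neg_add_cancel := fun a => Subtype.ext (R.hneg_add _ a.2)
    nsmul := nsmulRec
    zsmul := zsmulRec
    mul := fun a b => ⟨R.mul a b, R.mul_mem _ a.2 _ b.2⟩
    mul_assoc := fun a b c => Subtype.ext (R.hmul_assoc _ a.2 _ b.2 _ c.2)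
    one := ⟨Classical.choose h, (Classical.choose_spec h).1⟩
    one_mul := fun a => Subtype.ext (((Classical.choose_spec h).2 _ a.2).1)
    mul_one := fun a => Subtype.ext (((Classical.choose_spec h).2 _ a.2).2)
    left_distrib := fun a b c => Subtype.ext (R.hleft_distrib _ a.2 _ b.2 _ c.2)
    right_distrib := fun a b c => Subtype.ext (R.hright_distrib _ a.2 _ b.2 _ c.2)
    zero_mul := fun a => Subtype.ext (zero_mul' a.2)
    mul_zero := fun a => Subtype.ext (mul_zero' a.2)
    nsmul_zero := fun a => rfl
    nsmul_succ := fun n a => rfl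
    zsmul_zero' := fun a => rfl
    zsmul_succ' := fun n a => rfl
    zsmul_neg' := fun n a => rfl }

theorem IsFieldRing.unital {R : DefRing L M} (h : R.IsFieldRing) : R.IsUnital :=
  h.2.imp fun _ he => he.1

/-- The commutative ring structure on the carrier of a definable field. -/
noncomputable def commRingSub (h : R.IsFieldRing) : CommRing ↥R.carrier :=
  { R.ringSub h.unital with
    mul_comm := fun a b => by exact Subtype.ext (h.1 _ a.2 _ b.2) }

end DefRing

end OMin
namespace OMin

/-- `K(√-1)`: the quadratic extension `K[X]/(X² + 1)` of `K`, realized concretely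
on pairs. -/
structure Gauss (K : Type) where
  re : K
  im : K

namespace Gauss

variable {K : Type} [CommRing K]

@[ext] theorem ext {a b : Gauss K} (h1 : a.re = b.re) (h2 : a.im = b.im) : a = b := by
  cases a; cases b; cases h1; cases h2; rfl

instance : Add (Gauss K) := ⟨fun a b => ⟨a.re + b.re, a.im + b.im⟩⟩
instance : Mul (Gauss K) := ⟨fun a b => ⟨a.re * b.re - a.im * b.im, a.re * b.im + a.im * b.re⟩⟩
instance : Neg (Gauss K) := ⟨fun a => ⟨-a.re, -a.im⟩⟩
instance : Zero (Gauss K) := ⟨⟨0, 0⟩⟩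
instance : One (Gauss K) := ⟨⟨1, 0⟩⟩

@[simp] theorem add_re (a b : Gauss K) : (a + b).re = a.re + b.re := rfl
@[simp] theorem add_im (a b : Gauss K) : (a + b).im = a.im + b.im := rfl
@[simp] theorem mul_re (a b : Gauss K) : (a * b).re = a.re * b.re - a.im * b.im := rfl
@[simp] theorem mul_im (a b : Gauss K) : (a * b).im = a.re * b.im + a.im * b.re := rfl
@[simp] theorem neg_re (a : Gauss K) : (-a).re = -a.re := rfl
@[simp] theorem neg_im (a : Gauss K) : (-a).im = -a.im := rfl
@[simp] theorem zero_re : (0 : Gauss K).re = 0 := rfl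
@[simp] theorem zero_im : (0 : Gauss K).im = 0 := rfl
@[simp] theorem one_re : (1 : Gauss K).re = 1 := rfl
@[simp] theorem one_im : (1 : Gauss K).im = 0 := rfl

instance : CommRing (Gauss K) where
  add := (· + ·)
  add_assoc a b c := by ext <;> simp <;> ring
  zero := 0
  zero_add a := by ext <;> simp
  add_zero a := by ext <;> simp
  add_comm a b := by ext <;> simp <;> ring
  neg := Neg.neg
  neg_add_cancel a := by ext <;> simp
  nsmul := nsmulRec
  zsmul := zsmulRec
  mul := (· * ·)
  mul_assoc a b c := by ext <;> simp <;> ring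
  one := 1
  one_mul a := by ext <;> simp
  mul_one a := by ext <;> simp
  left_distrib a b c := by ext <;> simp <;> ring
  right_distrib a b c := by ext <;> simp <;> ring
  zero_mul a := by ext <;> simp
  mul_zero a := by ext <;> simp
  mul_comm a b := by ext <;> simp <;> ring

end Gauss

variable {L : FirstOrder.Language} {M : Type} [L.Structure M]

/-- An abstract field `F` isomorphic (as a ring, via `iso`) to the definable field `K`,
together with a finite-dimensional associative `F`-algebra `A` with nontrivial
multiplication and a (set-level) ring isomorphism `aiso` from the subring `S` of the
definable ring `R` onto `A`. -/
structure AlgebraCopy (K : DefRing L M) (R : DefRing L M) (S : Set (Fin R.k → M)) where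
  F : Type
  [fieldF : Field F]
  iso : (Fin K.k → M) → F
  bij : Set.BijOn iso K.carrier Set.univ
  map_add : ∀ x ∈ K.carrier, ∀ y ∈ K.carrier, iso (K.add x y) = iso x + iso y
  map_mul : ∀ x ∈ K.carrier, ∀ y ∈ K.carrier, iso (K.mul x y) = iso x * iso y
  A : Type
  [ringA : NonUnitalRing A]
  [moduleA : Module F A]
  [towerA : IsScalarTower F A A]
  [commA : SMulCommClass F A A]
  findim : FiniteDimensional F A
  notNull : ∃ a b : A, a * b ≠ 0
  aiso : (Fin R.k → M) → A
  abij : Set.BijOn aiso S Set.univ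
  amap_add : ∀ x ∈ S, ∀ y ∈ S, aiso (R.add x y) = aiso x + aiso y
  amap_mul : ∀ x ∈ S, ∀ y ∈ S, aiso (R.mul x y) = aiso x * aiso y

/-- The (abstract) ring `A` has nontrivial multiplication, i.e. is not a null ring. -/
def NotNullCarrier (A : Type) [NonUnitalRing A] : Prop := ∃ a b : A, a * b ≠ 0

/-- A finite-dimensional associative `F`-algebra `A` and a ring isomorphism from the
definable ring `R` onto the direct product `A × B`, for a definable ring `B`. -/
structure ProdSplit (F : Type) [Field F] (R : DefRing L M) (B : DefRing L M) where
  A : Type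
  [ringA : NonUnitalRing A]
  [moduleA : Module F A]
  [towerA : IsScalarTower F A A]
  [commA : SMulCommClass F A A]
  findim : FiniteDimensional F A
  f : (Fin R.k → M) → A × (Fin B.k → M)
  bij : Set.BijOn f R.carrier {p | p.2 ∈ B.carrier}
  map_add : ∀ x ∈ R.carrier, ∀ y ∈ R.carrier,
    f (R.add x y) = ((f x).1 + (f y).1, B.add (f x).2 (f y).2)
  map_mul : ∀ x ∈ R.carrier, ∀ y ∈ R.carrier,
    f (R.mul x y) = ((f x).1 * (f y).1, B.mul (f x).2 (f y).2)

/-- `D` (a definable ring in `M`) is a copy, via the canonical flattening of tuples,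
of the ring `Din`, which is definable in the pure ring structure `(B, +, ·)`. -/
def IsInnerCopy (B : DefRing L M) (Din : @DefRing ringLang ↥B.carrier B.innerStr)
    (D : DefRing L M) : Prop :=
  letI := B.innerStr
  ∃ e : Fin D.k ≃ (Fin Din.k × Fin B.k),
    ∃ g : (Fin Din.k → ↥B.carrier) → (Fin D.k → M),
      (∀ x i, g x i = (x (e i).1 : Fin B.k → M) (e i).2) ∧
      Set.BijOn g Din.carrier D.carrier ∧
      ∀ x ∈ Din.carrier, ∀ y ∈ Din.carrier,
        g (Din.add x y) = D.add (g x) (g y) ∧ g (Din.mul x y) = D.mul (g x) (g y)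

/-- `R` is definably isomorphic to the ring `M_n(D)` of `n × n` matrices over the
definable division ring `D`. -/
def MatrixIso (R D : DefRing L M) (hD : D.IsUnital) (n : ℕ) : Prop :=
  letI := D.ringSub hD
  ∃ f : (Fin R.k → M) → Matrix (Fin n) (Fin n) ↥D.carrier,
    Set.BijOn f R.carrier Set.univ ∧
    (∀ x ∈ R.carrier, ∀ y ∈ R.carrier,
      f (R.add x y) = f x + f y ∧ f (R.mul x y) = f x * f y) ∧
    Defin L M {p : (Fin R.k ⊕ Fin n × Fin n × Fin D.k) → M |
      (fun i => p (Sum.inl i)) ∈ R.carrier ∧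
      ∀ q : Fin n × Fin n × Fin D.k,
        ((f (fun i => p (Sum.inl i)) q.1 q.2.1 : ↥D.carrier) : Fin D.k → M) q.2.2 =
          p (Sum.inr q)}

/-- A definable scalar multiplication of the definable field `K` on the subset `S` of the
definable ring `R` making `S` a definable `K`-vector space. -/
def IsDefVectorSpaceOn (K R : DefRing L M) (S : Set (Fin R.k → M))
    (σ : (Fin K.k → M) → (Fin R.k → M) → (Fin R.k → M)) : Prop :=
  (∀ c ∈ K.carrier, ∀ x ∈ S, σ c x ∈ S) ∧
  Defin L M {p : (Fin K.k ⊕ Fin R.k ⊕ Fin R.k) → M |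
    (fun i => p (Sum.inl i)) ∈ K.carrier ∧ (fun i => p (Sum.inr (Sum.inl i))) ∈ S ∧
    σ (fun i => p (Sum.inl i)) (fun i => p (Sum.inr (Sum.inl i))) =
      fun i => p (Sum.inr (Sum.inr i))} ∧
  (∀ e, K.IsIdentity e → ∀ x ∈ S, σ e x = x) ∧
  (∀ c ∈ K.carrier, ∀ x ∈ S, ∀ y ∈ S, σ c (R.add x y) = R.add (σ c x) (σ c y)) ∧
  (∀ c ∈ K.carrier, ∀ d ∈ K.carrier, ∀ x ∈ S, σ (K.add c d) x = R.add (σ c x) (σ d x)) ∧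
  (∀ c ∈ K.carrier, ∀ d ∈ K.carrier, ∀ x ∈ S, σ (K.mul c d) x = σ c (σ d x))

/-- The subring `S` of `R` is a definable `K`-vector space and a definable associative
`K`-algebra. -/
def IsDefAlgebraOn (K R : DefRing L M) (S : Set (Fin R.k → M)) : Prop :=
  ∃ σ, IsDefVectorSpaceOn K R S σ ∧
    ∀ r ∈ K.carrier, ∀ s ∈ K.carrier, ∀ u ∈ S, ∀ v ∈ S,
      R.mul (σ r u) (σ s v) = σ (K.mul r s) (R.mul u v)

/-- `S` (a subring of the definable ring `R`) is definably isomorphic to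
`K^r × K(√-1)^p × ℍ(K)^q`, for the definable field `K`. -/
def GaussQuatIso (R : DefRing L M) (S : Set (Fin R.k → M)) (K : DefRing L M)
    (hK : K.IsFieldRing) (r p q : ℕ) : Prop :=
  letI := K.commRingSub hK
  ∃ f : (Fin R.k → M) →
      ((Fin r → ↥K.carrier) × (Fin p → Gauss ↥K.carrier) × (Fin q → Quaternion ↥K.carrier)),
    Set.BijOn f S Set.univ ∧
    (∀ x ∈ S, ∀ y ∈ S, f (R.add x y) = f x + f y ∧ f (R.mul x y) = f x * f y) ∧
    Defin L M {pp : (Fin R.k ⊕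
        ((Fin r × Fin K.k) ⊕ (Fin p × Fin 2 × Fin K.k) ⊕ (Fin q × Fin 4 × Fin K.k))) → M |
      (fun i => pp (Sum.inl i)) ∈ S ∧
      (∀ (a : Fin r) (c : Fin K.k),
        (((f (fun i => pp (Sum.inl i))).1 a : Fin K.k → M)) c =
          pp (Sum.inr (Sum.inl (a, c)))) ∧
      (∀ (a : Fin p) (c : Fin K.k),
        ((((f (fun i => pp (Sum.inl i))).2.1 a).re : Fin K.k → M)) c =
            pp (Sum.inr (Sum.inr (Sum.inl (a, 0, c)))) ∧
        ((((f (fun i => pp (Sum.inl i))).2.1 a).im : Fin K.k → M)) c =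
            pp (Sum.inr (Sum.inr (Sum.inl (a, 1, c))))) ∧
      (∀ (a : Fin q) (c : Fin K.k),
        ((((f (fun i => pp (Sum.inl i))).2.2 a).re : Fin K.k → M)) c =
            pp (Sum.inr (Sum.inr (Sum.inr (a, 0, c)))) ∧
        ((((f (fun i => pp (Sum.inl i))).2.2 a).imI : Fin K.k → M)) c =
            pp (Sum.inr (Sum.inr (Sum.inr (a, 1, c)))) ∧
        ((((f (fun i => pp (Sum.inl i))).2.2 a).imJ : Fin K.k → M)) c =
            pp (Sum.inr (Sum.inr (Sum.inr (a, 2, c)))) ∧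
        ((((f (fun i => pp (Sum.inl i))).2.2 a).imK : Fin K.k → M)) c =
            pp (Sum.inr (Sum.inr (Sum.inr (a, 3, c)))))}

end OMin
namespace OMin

section Interpretation

variable (L : FirstOrder.Language) (M : Type) [L.Structure M]

/-- A type identified with a definable set of tuples from `M`. -/
class DefType (X : Type) where
  /-- The index set of the tuples. -/
  ι : Type
  finite_ι : Finite ι
  /-- The tuple of coordinates of a point. -/
  emb : X → ι → M
  emb_injective : Function.Injective emb
  range_def : Defin L M (Set.range emb)

attribute [instance] DefType.finite_ι

instance : DefType L M M where
  ι := Unit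
  finite_ι := inferInstance
  emb x := fun _ => x
  emb_injective x y h := congrFun h ()
  range_def := by
    have h : Set.range (fun (x : M) (_ : Unit) => x) = Set.univ :=
      Set.range_eq_univ.2 fun u => ⟨u (), rfl⟩
    rw [h]
    exact Set.definable_univ

instance : DefType L M Unit where
  ι := Empty
  finite_ι := inferInstance
  emb _ := Empty.elim
  emb_injective _ _ _ := rfl
  range_def := by
    have h : Set.range (fun (_ : Unit) => (Empty.elim : Empty → M)) = Set.univ :=
      Set.range_eq_univ.2 fun u => ⟨(), Subsingleton.elim _ _⟩
    rw [h]
    exact Set.definable_univ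

instance {X Y : Type} [hX : DefType L M X] [hY : DefType L M Y] : DefType L M (X × Y) where
  ι := hX.ι ⊕ hY.ι
  finite_ι := inferInstance
  emb p := Sum.elim (hX.emb p.1) (hY.emb p.2)
  emb_injective := by
    rintro ⟨x, y⟩ ⟨x', y'⟩ h
    refine Prod.ext (hX.emb_injective ?_) (hY.emb_injective ?_)
    · exact funext fun i => congrFun h (Sum.inl i)
    · exact funext fun i => congrFun h (Sum.inr i)
  range_def := by
    refine (congrArg (Defin L M) (Set.ext fun u => ?_)).mpr
      ((hX.range_def.preimage_comp Sum.inl).inter (hY.range_def.preimage_comp Sum.inr))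
    constructor
    · rintro ⟨⟨x, y⟩, rfl⟩
      exact ⟨⟨x, rfl⟩, ⟨y, rfl⟩⟩
    · rintro ⟨⟨x, hx⟩, ⟨y, hy⟩⟩
      refine ⟨⟨x, y⟩, funext fun i => ?_⟩
      rcases i with i | i
      · exact congrFun hx i
      · exact congrFun hy i

variable {X Y Z : Type} [DefType L M X] [DefType L M Y] [DefType L M Z]

/-- A definable predicate. -/
def DefPred (P : X → Prop) : Prop :=
  ∃ D : Set (DefType.ι L M X → M), Defin L M D ∧ ∀ x, P x ↔ DefType.emb (L := L) x ∈ D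

variable {L M}

theorem DefPred.and {P Q : X → Prop} (hP : DefPred L M P) (hQ : DefPred L M Q) :
    DefPred L M fun x => P x ∧ Q x := by
  obtain ⟨D, hD, h⟩ := hP
  obtain ⟨E, hE, h'⟩ := hQ
  exact ⟨D ∩ E, hD.inter hE, fun x => and_congr (h x) (h' x)⟩

theorem DefPred.not {P : X → Prop} (hP : DefPred L M P) : DefPred L M fun x => ¬ P x := by
  obtain ⟨D, hD, h⟩ := hP
  exact ⟨Dᶜ, hD.compl, fun x => not_congr (h x)⟩

theorem DefPred.or {P Q : X → Prop} (hP : DefPred L M P) (hQ : DefPred L M Q) :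
    DefPred L M fun x => P x ∨ Q x := by
  obtain ⟨D, hD, h⟩ := hP
  obtain ⟨E, hE, h'⟩ := hQ
  exact ⟨D ∪ E, hD.union hE, fun x => or_congr (h x) (h' x)⟩

theorem DefPred.imp {P Q : X → Prop} (hP : DefPred L M P) (hQ : DefPred L M Q) :
    DefPred L M fun x => P x → Q x := by
  simpa only [imp_iff_not_or] using hP.not.or hQ

theorem DefPred.iff {P Q : X → Prop} (hP : DefPred L M P) (hQ : DefPred L M Q) :
    DefPred L M fun x => P x ↔ Q x := by
  simpa only [iff_iff_implies_and_implies] using (hP.imp hQ).and (hQ.imp hP)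

theorem DefPred.congr {P Q : X → Prop} (hP : DefPred L M P) (h : ∀ x, Q x ↔ P x) :
    DefPred L M Q := by
  obtain ⟨D, hD, h'⟩ := hP
  exact ⟨D, hD, fun x => (h x).trans (h' x)⟩

theorem DefPred.const (p : Prop) : DefPred L M fun _ : X => p := by
  by_cases hp : p
  · exact ⟨Set.univ, Set.definable_univ, by simp [hp]⟩
  · exact ⟨∅, Set.definable_empty, by simp [hp]⟩

theorem DefPred.ex {P : X → Y → Prop} (hP : DefPred L M fun p : X × Y => P p.1 p.2) :
    DefPred L M fun x => ∃ y, P x y := by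
  obtain ⟨D, hD, h⟩ := hP
  have hR := DefType.range_def (L := L) (M := M) (X := X × Y)
  refine ⟨_, (hD.inter hR).image_comp Sum.inl, fun x => ?_⟩
  constructor
  · rintro ⟨y, hy⟩
    exact ⟨_, ⟨(h (x, y)).1 hy, ⟨(x, y), rfl⟩⟩, rfl⟩
  · rintro ⟨_, ⟨hv, ⟨⟨x', y⟩, rfl⟩⟩, hx⟩
    obtain rfl : x' = x := DefType.emb_injective (L := L) (M := M) hx
    exact ⟨y, (h _).2 hv⟩

theorem DefPred.all {P : X → Y → Prop} (hP : DefPred L M fun p : X × Y => P p.1 p.2) :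
    DefPred L M fun x => ∀ y, P x y := by
  have h := (DefPred.ex (P := fun x y => ¬ P x y) hP.not).not
  simpa only [not_exists, not_not] using h

theorem DefPred.reindex {P : Y → Prop} (hP : DefPred L M P) (g : X → Y)
    (σ : DefType.ι L M Y → DefType.ι L M X)
    (hσ : ∀ x i, DefType.emb (L := L) (M := M) (g x) i = DefType.emb x (σ i)) :
    DefPred L M fun x => P (g x) := by
  obtain ⟨D, hD, h⟩ := hP
  refine ⟨_, hD.preimage_comp σ, fun x => ?_⟩
  exact (h (g x)).trans (iff_of_eq (congrArg (· ∈ D) (funext fun i => hσ x i)))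

theorem DefPred.eq_self : DefPred L M fun p : X × X => p.1 = p.2 := by
  refine ⟨⋂ i : DefType.ι L M X, {u | u (Sum.inl i) = u (Sum.inr i)}, ?_, ?_⟩
  · refine Set.definable_iInter_of_finite fun i => ?_
    have h := (Set.Definable.diagonal (L := L) (Set.univ : Set M)).preimage_comp
      (β := DefType.ι L M X ⊕ DefType.ι L M X) ![Sum.inl i, Sum.inr i]
    exact h
  · rintro ⟨x, y⟩
    simp only [Set.mem_iInter, Set.mem_ofPred_eq]
    constructor
    · rintro h i
      exact congrArg (fun z => DefType.emb (L := L) (M := M) z i) h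
    · exact fun h => DefType.emb_injective (L := L) (M := M) (funext h)

variable (L M) in
/-- A map with definable graph. -/
@[fun_prop]
def DefMap (f : X → Y) : Prop := DefPred L M fun p : X × Y => f p.1 = p.2

theorem DefMap.of_reindex (g : X → Y) (σ : DefType.ι L M Y → DefType.ι L M X)
    (hσ : ∀ x i, DefType.emb (L := L) (M := M) (g x) i = DefType.emb x (σ i)) :
    DefMap L M g :=
  (DefPred.eq_self (X := Y)).reindex (X := X × Y) (fun p => (g p.1, p.2)) (Sum.map σ id) <| by
    rintro ⟨x, y⟩ (i | i)
    · exact hσ x i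
    · rfl

@[fun_prop]
theorem DefMap.id' : DefMap L M fun x : X => x := .of_reindex _ id fun _ _ => rfl

@[fun_prop]
theorem DefMap.fst' : DefMap L M fun p : X × Y => p.1 := .of_reindex _ Sum.inl fun _ _ => rfl

@[fun_prop]
theorem DefMap.snd' : DefMap L M fun p : X × Y => p.2 := .of_reindex _ Sum.inr fun _ _ => rfl

@[fun_prop]
theorem DefMap.const' (c : Y) : DefMap L M fun _ : X => c := by
  refine ⟨⋂ i : DefType.ι L M Y, {u | u (Sum.inr i) = DefType.emb (L := L) c i}, ?_, ?_⟩
  · refine Set.definable_iInter_of_finite fun i => ?_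
    have h := (Set.Definable.singleton (L := L) (DefType.emb (L := L) c i)).preimage_comp
      (β := DefType.ι L M X ⊕ DefType.ι L M Y) (fun _ : Fin 1 => Sum.inr i)
    exact h.mono (Set.subset_univ _)
  · rintro ⟨x, y⟩
    simp only [Set.mem_iInter, Set.mem_ofPred_eq]
    constructor
    · rintro h i
      exact congrArg (fun z => DefType.emb (L := L) (M := M) z i) h.symm
    · exact fun h => (DefType.emb_injective (L := L) (M := M) (funext h)).symm

@[fun_prop]
theorem DefMap.prodMk {f : X → Y} {g : X → Z} (hf : DefMap L M f) (hg : DefMap L M g) :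
    DefMap L M fun x => (f x, g x) := by
  have h₁ := DefPred.reindex (X := X × (Y × Z)) hf (fun p => (p.1, p.2.1))
    (Sum.map id Sum.inl) (by rintro _ (i | i) <;> rfl)
  have h₂ := DefPred.reindex (X := X × (Y × Z)) hg (fun p => (p.1, p.2.2))
    (Sum.map id Sum.inr) (by rintro _ (i | i) <;> rfl)
  exact (h₁.and h₂).congr fun p => Prod.ext_iff

theorem DefPred.comp {P : Y → Prop} (hP : DefPred L M P) {f : X → Y} (hf : DefMap L M f) :
    DefPred L M fun x => P (f x) := by
  have h := DefPred.ex (X := X) (Y := Y) (P := fun x y => f x = y ∧ P y)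
    (hf.and (hP.reindex Prod.snd Sum.inr fun _ _ => rfl))
  exact h.congr fun x => by simp

@[fun_prop]
theorem DefMap.comp' {g : Y → Z} {f : X → Y} (hg : DefMap L M g) (hf : DefMap L M f) :
    DefMap L M fun x => g (f x) :=
  DefPred.comp (P := fun p : Y × Z => g p.1 = p.2) hg (f := fun p : X × Z => (f p.1, p.2)) <|
    DefMap.prodMk (DefPred.comp (P := fun p : X × Y => f p.1 = p.2) hf
      (f := fun p : (X × Z) × Y => (p.1.1, p.2)) (.of_reindex _ (Sum.map Sum.inl id)
        (by rintro _ (i | i) <;> rfl))) (.of_reindex _ Sum.inr fun _ _ => rfl)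

@[fun_prop]
theorem DefMap.fst {f : X → Y × Z} (hf : DefMap L M f) : DefMap L M fun x => (f x).1 :=
  DefMap.fst'.comp' hf

@[fun_prop]
theorem DefMap.snd {f : X → Y × Z} (hf : DefMap L M f) : DefMap L M fun x => (f x).2 :=
  DefMap.snd'.comp' hf

theorem DefPred.eq {f g : X → Y} (hf : DefMap L M f) (hg : DefMap L M g) :
    DefPred L M fun x => f x = g x :=
  DefPred.eq_self.comp (hf.prodMk hg)

theorem DefPred.comp₂ {P : Y → Z → Prop} (hP : DefPred L M fun p : Y × Z => P p.1 p.2)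
    {f : X → Y} {g : X → Z} (hf : DefMap L M f) (hg : DefMap L M g) :
    DefPred L M fun x => P (f x) (g x) :=
  DefPred.comp (P := fun p : Y × Z => P p.1 p.2) hP (hf.prodMk hg)

theorem DefPred.finite {P : X → Prop} (h : {x | P x}.Finite) : DefPred L M P := by
  suffices ∀ s : Set X, s.Finite → DefPred L M (· ∈ s) from this _ h
  intro s hs
  induction s, hs using Set.Finite.induction_on with
  | empty => exact DefPred.const False
  | insert _ _ ih => exact (DefPred.eq .id' (.const' _)).or ih

end Interpretation

section Tame

variable {M : Type*} [LinearOrder M]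

/-- A subset of a linear order is tame if membership in it is constant on intervals
avoiding some finite set. -/
def Tame (s : Set M) : Prop :=
  ∃ F : Finset M, ∀ x y, x ≤ y → (∀ z ∈ F, ¬ (x ≤ z ∧ z ≤ y)) → (x ∈ s ↔ y ∈ s)

theorem Tame.compl {s : Set M} (hs : Tame s) : Tame sᶜ := by
  obtain ⟨F, hF⟩ := hs
  exact ⟨F, fun x y hxy h => not_congr (hF x y hxy h)⟩

theorem Tame.inter {s t : Set M} (hs : Tame s) (ht : Tame t) : Tame (s ∩ t) := by
  classical
  obtain ⟨F, hF⟩ := hs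
  obtain ⟨E, hE⟩ := ht
  refine ⟨F ∪ E, fun x y hxy h => and_congr (hF x y hxy fun z hz => ?_) (hE x y hxy fun z hz => ?_)⟩
  · exact h z (Finset.mem_union_left _ hz)
  · exact h z (Finset.mem_union_right _ hz)

theorem Tame.union {s t : Set M} (hs : Tame s) (ht : Tame t) : Tame (s ∪ t) := by
  simpa [Set.compl_inter] using (hs.compl.inter ht.compl).compl

theorem Tame.dual {s : Set M} (hs : Tame s) : Tame (M := Mᵒᵈ) (OrderDual.ofDual ⁻¹' s) := by
  obtain ⟨F, hF⟩ := hs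
  refine ⟨F.map OrderDual.toDual.toEmbedding, fun x y hxy h => ?_⟩
  refine (hF (OrderDual.ofDual y) (OrderDual.ofDual x) hxy fun z hz hz' => ?_).symm
  exact h (OrderDual.toDual z) (Finset.mem_map_of_mem _ hz) ⟨hz'.2, hz'.1⟩

theorem tame_Iio (a : M) : Tame (Set.Iio a) := by
  refine ⟨{a}, fun x y hxy h => ?_⟩
  have := h a (by simp)
  simp only [Set.mem_Iio]
  grind

theorem tame_Ioi (a : M) : Tame (Set.Ioi a) := by
  refine ⟨{a}, fun x y hxy h => ?_⟩
  have := h a (by simp)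
  simp only [Set.mem_Ioi]
  grind

theorem tame_Ioo (a b : M) : Tame (Set.Ioo a b) := (tame_Ioi a).inter (tame_Iio b)

theorem tame_univ : Tame (Set.univ : Set M) := ⟨∅, by simp⟩

theorem tame_singleton (a : M) : Tame ({a} : Set M) := by
  have h := ((tame_Iio a).union (tame_Ioi a)).compl
  rwa [Set.Iio_union_Ioi, compl_compl] at h

theorem tame_iUnion {n : ℕ} {t : Fin n → Set M} (h : ∀ i, Tame (t i)) : Tame (⋃ i, t i) := by
  classical
  choose F hF using h
  refine ⟨Finset.univ.biUnion F, fun x y hxy h => ?_⟩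
  simp only [Set.mem_iUnion]
  exact exists_congr fun i => hF i x y hxy fun z hz =>
    h z (Finset.mem_biUnion.2 ⟨i, Finset.mem_univ _, hz⟩)

theorem Tame.exists_Icc_subset {s : Set M} (hs : Tame s) (hinf : s.Infinite) :
    ∃ a b, a < b ∧ Set.Icc a b ⊆ s := by
  classical
  obtain ⟨F, hF⟩ := hs
  have hinf' : (s \ F).Infinite := hinf.sdiff F.finite_toSet
  obtain ⟨x, hx, y, hy, hne, hxy⟩ := hinf'.exists_ne_map_eq_of_mapsTo
    (f := fun x => F.filter (· < x)) (t := (F.powerset : Set (Finset M)))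
    (fun x _ => Finset.mem_coe.2 (Finset.mem_powerset.2 (Finset.filter_subset _ _)))
    (Finset.finite_toSet _)
  wlog hlt : x < y generalizing x y
  · exact this y hy x hx hne.symm hxy.symm (lt_of_le_of_ne (not_lt.1 hlt) hne.symm)
  refine ⟨x, y, hlt, fun w hw => (hF x w hw.1 fun z hz hz' => ?_).1 hx.1⟩
  have hzx : z ≠ x := fun h => hx.2 (h ▸ hz)
  have hzy : z ≠ y := fun h => hy.2 (h ▸ hz)
  have h1 : z ∈ F.filter (· < y) :=
    Finset.mem_filter.2 ⟨hz, lt_of_le_of_ne (hz'.2.trans hw.2) hzy⟩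
  rw [← hxy] at h1
  exact absurd (Finset.mem_filter.1 h1).2 (not_lt.2 hz'.1)

theorem Tame.right_germ [NoMaxOrder M] {s : Set M} (hs : Tame s) (c : M) :
    ∃ b, c < b ∧ (Set.Ioo c b ⊆ s ∨ Set.Ioo c b ⊆ sᶜ) := by
  classical
  obtain ⟨F, hF⟩ := hs
  obtain ⟨b, hcb, hb⟩ : ∃ b, c < b ∧ ∀ z ∈ F, ¬ (c < z ∧ z < b) := by
    by_cases hne : (F.filter (c < ·)).Nonempty
    · refine ⟨(F.filter (c < ·)).min' hne, ?_, fun z hz hz' => ?_⟩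
      · exact (Finset.mem_filter.1 (Finset.min'_mem _ hne)).2
      · exact absurd (Finset.min'_le _ z (Finset.mem_filter.2 ⟨hz, hz'.1⟩)) (not_le.2 hz'.2)
    · obtain ⟨b, hb⟩ := exists_gt c
      exact ⟨b, hb, fun z hz hz' => hne ⟨z, Finset.mem_filter.2 ⟨hz, hz'.1⟩⟩⟩
  refine ⟨b, hcb, ?_⟩
  by_contra! hcon
  obtain ⟨h1, h2⟩ := hcon
  obtain ⟨x, hx, hxs⟩ := Set.not_subset.1 h1
  obtain ⟨y, hy, hys⟩ := Set.not_subset.1 h2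
  rw [Set.mem_compl_iff, not_not] at hys
  rcases le_total x y with h | h
  · exact hxs ((hF x y h fun z hz hz' => hb z hz ⟨hx.1.trans_le hz'.1, hz'.2.trans_lt hy.2⟩).2 hys)
  · exact hxs ((hF y x h fun z hz hz' => hb z hz ⟨hy.1.trans_le hz'.1, hz'.2.trans_lt hx.2⟩).1 hys)

theorem Tame.left_germ [NoMinOrder M] {s : Set M} (hs : Tame s) (c : M) :
    ∃ a, a < c ∧ (Set.Ioo a c ⊆ s ∨ Set.Ioo a c ⊆ sᶜ) := by
  obtain ⟨b, hb, h⟩ := hs.dual.right_germ (OrderDual.toDual c)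
  refine ⟨OrderDual.ofDual b, hb, h.imp (fun h x hx => ?_) fun h x hx => ?_⟩
  · exact @h (OrderDual.toDual x) ⟨hx.2, hx.1⟩
  · exact @h (OrderDual.toDual x) ⟨hx.2, hx.1⟩

theorem Tame.exists_isLUB [DenselyOrdered M] {s : Set M} (hs : Tame s) (hne : s.Nonempty)
    (hb : BddAbove s) : ∃ z, IsLUB s z := by
  classical
  obtain ⟨F, hF⟩ := hs
  obtain ⟨b, hb⟩ := hb
  obtain ⟨x, hx⟩ := hne
  have hU : ((insert b F).filter (· ∈ upperBounds s)).Nonempty :=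
    ⟨b, Finset.mem_filter.2 ⟨Finset.mem_insert_self _ _, hb⟩⟩
  refine ⟨_, (Finset.mem_filter.1 (Finset.min'_mem _ hU)).2, fun u hu => not_lt.1 fun hlt => ?_⟩
  obtain ⟨w, huw, hwm⟩ := exists_between hlt
  obtain ⟨y, hys, hy⟩ : ∃ y ∈ s, ∀ z ∈ F, z ∉ upperBounds s → z < y := by
    obtain ⟨G, hG⟩ : ∃ G : Finset M, ∀ z, z ∈ G ↔ z ∈ F ∧ z ∉ upperBounds s :=
      ⟨F.filter (· ∉ upperBounds s), fun z => Finset.mem_filter⟩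
    rcases G.eq_empty_or_nonempty with hP | hP
    · exact ⟨x, hx, fun z hz hz' => absurd ((hG z).2 ⟨hz, hz'⟩) (hP ▸ Finset.notMem_empty z)⟩
    · obtain ⟨y, hy, hlt⟩ : ∃ y ∈ s, G.max' hP < y := by
        by_contra! hcon
        exact ((hG _).1 (G.max'_mem hP)).2 hcon
      exact ⟨y, hy, fun z hz hz' => (G.le_max' z ((hG z).2 ⟨hz, hz'⟩)).trans_lt hlt⟩
  have hws : w ∈ s := by
    refine (hF y w ((hu hys).trans huw.le) fun z hz hz' => ?_).1 hys
    by_cases hzu : z ∈ upperBounds s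
    · refine absurd (Finset.min'_le _ z (Finset.mem_filter.2 ⟨Finset.mem_insert_of_mem hz, hzu⟩))
        (not_le.2 (hz'.2.trans_lt hwm))
    · exact absurd (hy z hz hzu) (not_lt.2 hz'.1)
  exact absurd (hu hws) (not_le.2 huw)

/-- The value of `f` at `x` is larger than at all other points near `x`. -/
def StrictLocalMax {O : Type*} [LinearOrder O] (f : M → O) (x : M) : Prop :=
  ∃ a b, a < x ∧ x < b ∧ ∀ y, a < y → y < b → y ≠ x → f y < f x

/-- The values of `f` immediately to the right of `x` exceed those immediately to the left. -/
def JumpUp {O : Type*} [LinearOrder O] (f : M → O) (x : M) : Prop :=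
  ∃ a b, a < x ∧ x < b ∧ ∀ y z, a < y → y < x → x < z → z < b → f y < f z

theorem exists_jumpUp [DenselyOrdered M] [NoMinOrder M] {O : Type*} [LinearOrder O]
    {f : M → O} (h₁ : ∀ c, Tame {y | f y < f c})
    (h₂ : ∀ q, Tame {x | ∀ y, x < y → y < q → f y < f x}) {p q : M} (hpq : p < q)
    (hmax : ∀ x, p < x → x < q → StrictLocalMax f x) : ∃ x, p < x ∧ x < q ∧ JumpUp f x := by
  obtain ⟨p', hpp', hp'q, hstar⟩ :
      ∃ p', p ≤ p' ∧ p' < q ∧ ∀ x, p' < x → x < q → ∃ y, x < y ∧ y < q ∧ f x ≤ f y := by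
    obtain ⟨a, haq, ha⟩ := (h₂ q).left_germ q
    refine ⟨max p a, le_max_left _ _, max_lt hpq haq, ?_⟩
    rcases ha with ha | ha
    · obtain ⟨x, hx, hxq⟩ := exists_between (max_lt hpq haq)
      obtain ⟨a', b', ha', hb', hm⟩ := hmax x ((le_max_left _ _).trans_lt hx) hxq
      obtain ⟨y, hy, hyx⟩ := exists_between (max_lt ha' hx)
      have hya : a < y := (le_max_right _ _).trans_lt ((le_max_right _ _).trans_lt hy)
      have h3 := ha ⟨hya, hyx.trans hxq⟩ x hyx hxq
      have h4 := hm y ((le_max_left _ _).trans_lt hy) (hyx.trans hb') hyx.ne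
      exact absurd h3 h4.not_gt
    · intro x hx hxq
      have := ha ⟨(le_max_right _ _).trans_lt hx, hxq⟩
      simpa only [Set.mem_compl_iff, Set.mem_ofPred_eq, not_forall, not_lt, exists_prop] using this
  have hge : ∀ c, p' < c → c < q → ∃ a, a < q ∧ ∀ y, a < y → y < q → f c ≤ f y := by
    intro c hc hcq
    obtain ⟨a, haq, ha⟩ := (h₁ c).left_germ q
    rcases ha with ha | ha
    swap
    · exact ⟨a, haq, fun y h h' => not_lt.1 (ha ⟨h, h'⟩)⟩
    exfalso
    have hs : Tame (Set.Iio q ∩ {y | f y < f c}ᶜ) := (tame_Iio q).inter (h₁ c).compl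
    have hca : c ∈ Set.Iio q ∩ {y | f y < f c}ᶜ := ⟨hcq, lt_irrefl _⟩
    have hbd : a ∈ upperBounds (Set.Iio q ∩ {y | f y < f c}ᶜ) := fun y hy =>
      not_lt.1 fun hay => hy.2 (ha ⟨hay, hy.1⟩)
    obtain ⟨z, hz⟩ := hs.exists_isLUB ⟨c, hca⟩ ⟨a, hbd⟩
    have hcz : c ≤ z := hz.1 hca
    have hzq : z < q := (hz.2 hbd).trans_lt haq
    rcases le_or_gt (f c) (f z) with hfz | hfz
    · obtain ⟨y, hzy, hyq, hfy⟩ := hstar z (hc.trans_le hcz) hzq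
      exact absurd (hz.1 ⟨hyq, not_lt.2 (hfz.trans hfy)⟩) (not_le.2 hzy)
    · obtain ⟨a', b', ha', hb', hm⟩ := hmax z (hpp'.trans_lt (hc.trans_le hcz)) hzq
      obtain ⟨y, hys, hay, hyz⟩ := hz.exists_between ha'
      have hne : y ≠ z := by
        rintro rfl
        exact hys.2 hfz
      exact hys.2 ((hm y hay (hyz.trans_lt hb') hne).trans hfz)
  obtain ⟨c, hpc, hcq⟩ := exists_between hp'q
  obtain ⟨a, haq, ha⟩ := hge c hpc hcq
  have hs : Tame (Set.Ioo c q ∩ {y | f y < f c}) := (tame_Ioo c q).inter (h₁ c)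
  have hbd : a ∈ upperBounds (Set.Ioo c q ∩ {y | f y < f c}) := fun y hy =>
    not_lt.1 fun hay => absurd hy.2 (not_lt.2 (ha y hay hy.1.2))
  obtain ⟨x, hx⟩ : (Set.Ioo c q ∩ {y | f y < f c}).Nonempty := by
    obtain ⟨a', b', ha', hb', hm⟩ := hmax c (hpp'.trans_lt hpc) hcq
    obtain ⟨y, hcy, hy⟩ := exists_between (lt_min hb' hcq)
    exact ⟨y, ⟨hcy, hy.trans_le (min_le_right _ _)⟩,
      hm y (ha'.trans hcy) (hy.trans_le (min_le_left _ _)) hcy.ne'⟩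
  obtain ⟨z, hz⟩ := hs.exists_isLUB ⟨x, hx⟩ ⟨a, hbd⟩
  have hcz : c < z := hx.1.1.trans_le (hz.1 hx)
  have hzq : z < q := (hz.2 hbd).trans_lt haq
  have hright : ∀ y, z < y → y < q → f c ≤ f y := fun y hzy hyq =>
    not_lt.1 fun hlt => absurd (hz.1 ⟨⟨hcz.trans hzy, hyq⟩, hlt⟩) (not_le.2 hzy)
  have hfz : f c ≤ f z := by
    by_contra! hfz
    obtain ⟨a', b', ha', hb', hm⟩ := hmax z ((hpp'.trans_lt hpc).trans hcz) hzq
    obtain ⟨y, hzy, hy⟩ := exists_between (lt_min hb' hzq)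
    have h3 := hright y hzy (hy.trans_le (min_le_right _ _))
    have h4 := hm y (ha'.trans hzy) (hy.trans_le (min_le_left _ _)) hzy.ne'
    exact absurd (h3.trans_lt h4) (not_lt.2 hfz.le)
  obtain ⟨a', haz, ha'⟩ := (h₁ c).left_germ z
  have hleft : Set.Ioo a' z ⊆ {y | f y < f c} := by
    refine ha'.resolve_right fun hcon => ?_
    obtain ⟨y, hys, hay, hyz⟩ := hz.exists_between haz
    rcases hyz.lt_or_eq with hlt | rfl
    · exact hcon ⟨hay, hlt⟩ hys.2
    · exact absurd hys.2 (not_lt.2 hfz)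
  exact ⟨z, (hpp'.trans_lt hpc).trans hcz, hzq, a', q, haz, hzq, fun y w hy hyz hzw hwq =>
    (hleft ⟨hy, hyz⟩).trans_le (hright w hzw hwq)⟩

theorem exists_not_strictLocalMax [DenselyOrdered M] [NoMinOrder M] [NoMaxOrder M]
    {O : Type*} [LinearOrder O] {f : M → O} (h₁ : ∀ c, Tame {y | f y < f c})
    (h₂ : ∀ q, Tame {x | ∀ y, x < y → y < q → f y < f x})
    (h₃ : ∀ p, Tame {x | ∀ y, y < x → p < y → f y < f x})
    (h₄ : Tame {x | JumpUp f x}) {p q : M} (hpq : p < q) :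
    ∃ x, p < x ∧ x < q ∧ ¬ StrictLocalMax f x := by
  by_contra! hmax
  obtain ⟨a, haq, ha⟩ := h₄.left_germ q
  have hlt := max_lt hpq haq
  obtain ⟨x, hx, hxq, hjump⟩ := exists_jumpUp h₁ h₂ hlt fun x hx hxq =>
    hmax x ((le_max_left _ _).trans_lt hx) hxq
  have hall : Set.Ioo a q ⊆ {x | JumpUp f x} :=
    ha.resolve_right fun h => h ⟨(le_max_right _ _).trans_lt hx, hxq⟩ hjump
  obtain ⟨z, hzq, hz, hjump'⟩ := exists_jumpUp (M := Mᵒᵈ)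
    (f := fun x => f (OrderDual.ofDual x)) (fun c => (h₁ c).dual) (fun q => (h₃ q).dual)
    (p := OrderDual.toDual q) (q := OrderDual.toDual (max p a)) hlt fun x hxq hx => by
      obtain ⟨a', b', ha', hb', hm⟩ := hmax x (lt_of_le_of_lt (le_max_left p a) hx) hxq
      exact ⟨b', a', hb', ha', fun y h h' hne => hm y h' h hne⟩
  obtain ⟨a₁, b₁, ha₁, hb₁, h₅⟩ := @hall (OrderDual.ofDual z)
    ⟨lt_of_le_of_lt (le_max_right p a) hz, hzq⟩
  obtain ⟨b₂, a₂, hb₂, ha₂, h₆⟩ := hjump'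
  change OrderDual.ofDual z < OrderDual.ofDual b₂ at hb₂
  change OrderDual.ofDual a₂ < OrderDual.ofDual z at ha₂
  obtain ⟨y, hy, hyz⟩ := exists_between (max_lt ha₁ ha₂)
  obtain ⟨w, hzw, hw⟩ := exists_between (lt_min hb₁ hb₂)
  have hay : OrderDual.ofDual a₂ < y := (le_max_right _ _).trans_lt hy
  have h7 := h₅ y w ((le_max_left _ _).trans_lt hy) hyz hzw (hw.trans_le (min_le_left _ _))
  have h8 := h₆ (OrderDual.toDual w) (OrderDual.toDual y) (hw.trans_le (min_le_right _ _)) hzw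
    hyz hay
  exact absurd h7 h8.not_gt

end Tame

section Families

variable {L : FirstOrder.Language} {M : Type} [L.Structure M] [LinearOrder M]

variable (L M) in
/-- O-minimality in terms of definable predicates and tame sets. -/
class TameStructure : Prop where
  lt_def : DefPred L M fun p : M × M => p.1 < p.2
  tame : ∀ P : M → Prop, DefPred L M P → Tame {x | P x}

theorem OMinimal.tameStructure (hM : OMinimal L M) : TameStructure L M := by
  obtain ⟨-, -, -, -, hlt, htame⟩ := hM
  refine ⟨⟨{x : Unit ⊕ Unit → M | x (Sum.inl ()) < x (Sum.inr ())}, ?_, fun p => Iff.rfl⟩, ?_⟩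
  · exact hlt.preimage_comp (β := Unit ⊕ Unit) ![Sum.inl (), Sum.inr ()]
  · rintro P ⟨D, hD, h⟩
    obtain ⟨n, t, ht, hs⟩ := htame {x | P x} <| by
      have hE : {x : Fin 1 → M | x 0 ∈ {x | P x}} = (fun g => g ∘ fun _ => 0) ⁻¹' D :=
        Set.ext fun x => h (x 0)
      rw [hE]
      exact hD.preimage_comp (β := Fin 1) fun _ => 0
    rw [hs]
    refine tame_iUnion fun i => ?_
    rcases ht i with ⟨a, h⟩ | ⟨a, b, h⟩ | ⟨a, h⟩ | ⟨a, h⟩ | h <;> rw [h]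
    · exact tame_singleton a
    · exact tame_Ioo a b
    · exact tame_Ioi a
    · exact tame_Iio a
    · exact tame_univ

variable [TameStructure L M] {X : Type} [DefType L M X]

theorem DefPred.lt {f g : X → M} (hf : DefMap L M f) (hg : DefMap L M g) :
    DefPred L M fun x => f x < g x :=
  (TameStructure.lt_def (L := L)).comp₂ hf hg

theorem DefPred.le {f g : X → M} (hf : DefMap L M f) (hg : DefMap L M g) :
    DefPred L M fun x => f x ≤ g x :=
  (DefPred.lt hg hf).not.congr fun _ => not_lt.symm

theorem DefPred.tame {P : M → Prop} (h : DefPred L M P) : Tame {x | P x} :=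
  TameStructure.tame P h

variable [DenselyOrdered M]

/-- The number of members of a definable family containing sets of a monotone chain `K` is finite
as soon as this holds for each set of the chain. -/
theorem finite_image_of_chain {T : X → Set M} (hT : DefPred L M fun p : X × M => p.2 ∈ T p.1)
    {P : X → Prop} (hP : DefPred L M P) {K : M → Set M}
    (hK : DefPred L M fun p : M × M => p.2 ∈ K p.1) (hmono : Monotone K) {D : Set M}
    (hup : ∀ u ∈ D, ∀ v, u ≤ v → v ∈ D) (hmin : ∀ u ∈ D, ∃ v ∈ D, v < u)
    (hfin : ∀ u ∈ D, (T '' {x | K u ⊆ T x}).Finite) (hex : ∀ x, P x → ∃ u ∈ D, K u ⊆ T x) :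
    (T '' {x | P x}).Finite := by
  rcases D.eq_empty_or_nonempty with rfl | ⟨u₀, hu₀⟩
  · have h : {x | P x} = ∅ := Set.eq_empty_of_forall_notMem fun x hx => by simpa using hex x hx
    simp [h]
  have hdefT : DefPred L M fun p : X × M => K p.2 ⊆ T p.1 :=
    DefPred.all (X := X × M) (P := fun p t => t ∈ K p.2 → t ∈ T p.1) <|
      .imp (hK.comp₂ (P := fun u t => t ∈ K u) (by fun_prop) (by fun_prop))
        (hT.comp₂ (P := fun x t => t ∈ T x) (by fun_prop) (by fun_prop))
  let J : Set M := {s | s ≤ u₀ ∧ ∃ x, P x ∧ IsLUB {u | K u ⊆ T x} s}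
  have hJmem : ∀ s ∈ J, ∃ x, P x ∧ IsLUB {u | K u ⊆ T x} s ∧ s ∈ D := by
    rintro s ⟨-, x, hx, hs⟩
    obtain ⟨u, hu, hux⟩ := hex x hx
    exact ⟨x, hx, hs, hup u hu s (hs.1 hux)⟩
  have hlub : ∀ x s v, IsLUB {u | K u ⊆ T x} s → v < s → K v ⊆ T x := by
    intro x s v hs hv
    obtain ⟨w, hw, hvw, -⟩ := hs.exists_between hv
    exact (hmono hvw.le).trans hw
  by_cases hJ : J.Finite
  · choose! v hv hvs using hmin
    refine ((hfin u₀ hu₀).union (hJ.biUnion' fun s hs => hfin (v s) ?_)).subset ?_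
    · exact hv s (hJmem s hs).choose_spec.2.2
    rintro _ ⟨x, hx, rfl⟩
    by_cases hxu : K u₀ ⊆ T x
    · exact Or.inl ⟨x, hxu, rfl⟩
    have hbd : u₀ ∈ upperBounds {u | K u ⊆ T x} := fun u hu =>
      le_of_not_gt fun hlt => hxu ((hmono hlt.le).trans hu)
    have htame : Tame {u | K u ⊆ T x} := by
      refine DefPred.tame (L := L) ?_
      exact hdefT.comp₂ (P := fun x u => K u ⊆ T x) (by fun_prop) (by fun_prop)
    obtain ⟨u, -, hux⟩ := hex x hx
    obtain ⟨s, hs⟩ := htame.exists_isLUB ⟨u, hux⟩ ⟨u₀, hbd⟩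
    have hsJ : s ∈ J := ⟨hs.2 hbd, x, hx, hs⟩
    refine Or.inr (Set.mem_biUnion hsJ ⟨x, hlub x s _ hs (hvs s ?_), rfl⟩)
    obtain ⟨u', hu', hux'⟩ := hex x hx
    exact hup u' hu' s (hs.1 hux')
  · exfalso
    have hJtame : Tame J := by
      refine DefPred.tame (L := L) ?_
      refine .and (.le (by fun_prop) (by fun_prop)) (.ex (.and (hP.comp (by fun_prop)) ?_))
      have h₁ : DefPred L M fun p : X × M => ∀ u, K u ⊆ T p.1 → u ≤ p.2 :=
        .all (.imp (hdefT.comp₂ (P := fun x u => K u ⊆ T x) (by fun_prop) (by fun_prop))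
          (.le (by fun_prop) (by fun_prop)))
      have h₂ : DefPred L M fun p : X × M => IsLUB {u | K u ⊆ T p.1} p.2 := by
        refine (h₁.and (DefPred.all (X := X × M) (P := fun p w =>
          (∀ u, K u ⊆ T p.1 → u ≤ w) → p.2 ≤ w) (.imp ?_ (.le (by fun_prop) (by fun_prop))))).congr
            fun p => Iff.rfl
        exact h₁.comp₂ (P := fun x w => ∀ u, K u ⊆ T x → u ≤ w) (by fun_prop) (by fun_prop)
      exact h₂.comp₂ (P := fun x s => IsLUB {u | K u ⊆ T x} s) (by fun_prop) (by fun_prop)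
    obtain ⟨a, b, hab, hsub⟩ := hJtame.exists_Icc_subset hJ
    have haD : a ∈ D := (hJmem a (hsub ⟨le_rfl, hab.le⟩)).choose_spec.2.2
    have : Nonempty X := ⟨(hJmem a (hsub ⟨le_rfl, hab.le⟩)).choose⟩
    choose! x hx hxs hxD using hJmem
    refine (Set.Ioo_infinite hab) (Set.Finite.of_finite_image (f := fun s => T (x s))
      ((hfin a haD).subset ?_) ?_)
    · rintro _ ⟨s, hs, rfl⟩
      exact ⟨x s, hlub _ s a (hxs s (hsub ⟨hs.1.le, hs.2.le⟩)) hs.1, rfl⟩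
    · intro s hs s' hs' heq
      have h₁ := hxs s (hsub ⟨hs.1.le, hs.2.le⟩)
      have h₂ := hxs s' (hsub ⟨hs'.1.le, hs'.2.le⟩)
      simp only at heq
      rw [heq] at h₁
      exact h₁.unique h₂

theorem Tame.exists_left_end {s : Set M} (hs : Tame s) (hinf : s.Infinite) :
    (∃ b, Set.Iio b ⊆ s) ∨ ∃ c b, c < b ∧ Set.Ioo c b ⊆ s ∧ ∀ w, w < c → ¬ Set.Ioc w c ⊆ s := by
  obtain ⟨a, b, hab, hsub⟩ := hs.exists_Icc_subset hinf
  have hbd : a ∈ upperBounds (Set.Iio b ∩ sᶜ) := fun t ht =>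
    le_of_not_gt fun hat => ht.2 (hsub ⟨hat.le, ht.1.le⟩)
  rcases (Set.Iio b ∩ sᶜ).eq_empty_or_nonempty with he | hne
  · refine Or.inl ⟨b, fun t ht => ?_⟩
    by_contra hts
    exact Set.notMem_empty t (he ▸ ⟨ht, hts⟩)
  obtain ⟨c, hc⟩ := ((tame_Iio b).inter hs.compl).exists_isLUB hne ⟨a, hbd⟩
  have hcb : c < b := (hc.2 hbd).trans_lt hab
  refine Or.inr ⟨c, b, hcb, fun t ht => ?_, fun w hw hsub' => ?_⟩
  · by_contra hts
    exact absurd (hc.1 ⟨ht.2, hts⟩) (not_le.2 ht.1)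
  · obtain ⟨t, ht, hwt, htc⟩ := hc.exists_between hw
    exact ht.2 (hsub' ⟨hwt, htc⟩)

/-- If every point outside a finite set lies in only finitely many members of a definable family
of subsets of `M`, then the family has only finitely many infinite members. -/
theorem finite_image_infinite [NoMinOrder M] [NoMaxOrder M] {T : X → Set M}
    (hT : DefPred L M fun p : X × M => p.2 ∈ T p.1) {S : Set M} (hS : S.Finite)
    (hfin : ∀ t ∉ S, (T '' {x | t ∈ T x}).Finite) : (T '' {x | (T x).Infinite}).Finite := by
  have hIoo : ∀ a b, a < b → (T '' {x | Set.Ioo a b ⊆ T x}).Finite := by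
    intro a b hab
    obtain ⟨t, ht, htS⟩ := (Set.Ioo_infinite hab).exists_notMem_finite hS
    exact (hfin t htS).subset (Set.image_mono fun x hx => hx ht)
  let E : X → M → M → Prop := fun x c u =>
    c < u ∧ Set.Ioo c u ⊆ T x ∧ ∀ w, w < c → ¬ Set.Ioc w c ⊆ T x
  have hTm {Y : Type} [DefType L M Y] {f : Y → X} {g : Y → M} (hf : DefMap L M f)
      (hg : DefMap L M g) : DefPred L M fun y => g y ∈ T (f y) :=
    hT.comp₂ (P := fun x t => t ∈ T x) hf hg
  have hIooDef : DefPred L M fun p : X × M × M => Set.Ioo p.2.1 p.2.2 ⊆ T p.1 :=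
    .all (.imp (.and (.lt (by fun_prop) (by fun_prop)) (.lt (by fun_prop) (by fun_prop)))
      (hTm (by fun_prop) (by fun_prop)))
  have hIocDef : DefPred L M fun p : X × M × M => Set.Ioc p.2.1 p.2.2 ⊆ T p.1 :=
    .all (.imp (.and (.lt (by fun_prop) (by fun_prop)) (.le (by fun_prop) (by fun_prop)))
      (hTm (by fun_prop) (by fun_prop)))
  have hEDef : DefPred L M fun p : X × M × M => E p.1 p.2.1 p.2.2 :=
    .and (.lt (by fun_prop) (by fun_prop)) <| .and hIooDef <| .all <|
      .imp (.lt (by fun_prop) (by fun_prop)) <| .not <|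
        hIocDef.comp₂ (P := fun x (q : M × M) => Set.Ioc q.1 q.2 ⊆ T x)
          (g := fun y : (X × M × M) × M => (y.2, y.1.2.1)) (by fun_prop) (by fun_prop)
  have hEm {Y : Type} [DefType L M Y] {f : Y → X} {g h : Y → M} (hf : DefMap L M f)
      (hg : DefMap L M g) (hh : DefMap L M h) : DefPred L M fun y => E (f y) (g y) (h y) :=
    hEDef.comp₂ (P := fun x (q : M × M) => E x q.1 q.2) hf (hg.prodMk hh)
  have hEu : ∀ x y c c' u, T x = T y → E x c u → E y c' u → c = c' := by
    have key : ∀ x y c c' u, T x = T y → E x c u → E y c' u → c' ≤ c :=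
      fun x y c c' u hxy h h' => le_of_not_gt fun hlt =>
        h'.2.2 c hlt fun t ht => hxy ▸ h.2.1 ⟨ht.1, ht.2.trans_lt h'.1⟩
    exact fun x y c c' u hxy h h' =>
      le_antisymm (key y x c' c u hxy.symm h' h) (key x y c c' u hxy h h')
  have hEmono : ∀ {x c u v}, E x c u → v ≤ u → c < v → E x c v := fun h hvu hcv =>
    ⟨hcv, (Set.Ioo_subset_Ioo_right hvu).trans h.2.1, h.2.2⟩
  have hIio : (T '' {x | ∃ b, Set.Iio b ⊆ T x}).Finite := by
    refine finite_image_of_chain hT ?_ (K := Set.Iio) (D := Set.univ) ?_ ?_ ?_ ?_ ?_ ?_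
    · exact .ex (.all (.imp (.lt (by fun_prop) (by fun_prop)) (hTm (by fun_prop) (by fun_prop))))
    · exact .lt (by fun_prop) (by fun_prop)
    · exact fun a b => Set.Iio_subset_Iio
    · simp
    · exact fun u _ => (exists_lt u).imp fun v hv => ⟨trivial, hv⟩
    · intro u _
      obtain ⟨a, ha⟩ := exists_lt u
      exact (hIoo a u ha).subset (Set.image_mono fun x hx => Set.Ioo_subset_Iio_self.trans hx)
    · simp
  let B : Set M := {c | ∃ x u, E x c u}
  have hBfin : B.Finite := by
    by_contra hB
    have hBt : Tame B := by
      refine DefPred.tame (L := L) ?_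
      exact .ex (.ex (hEm (by fun_prop) (by fun_prop) (by fun_prop)))
    obtain ⟨p, q, hpq, hsub⟩ := hBt.exists_Icc_subset hB
    let f : M → LowerSet M := fun c =>
      ⟨{v | ∃ u, v ≤ u ∧ ∃ x, E x c u}, fun v w hwv ⟨u, hu, h⟩ => ⟨u, hwv.trans hu, h⟩⟩
    have hfmem : ∀ {c u}, c < u → (u ∈ f c ↔ ∃ x, E x c u) := fun {c u} hcu =>
      ⟨fun ⟨v, hv, x, hx⟩ => ⟨x, hEmono hx hv hcu⟩, fun h => ⟨u, le_rfl, h⟩⟩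
    have hflt : ∀ c d, f c < f d ↔ ∃ v, v ∈ f d ∧ v ∉ f c := fun c d => by
      rw [← not_le, ← LowerSet.coe_subset_coe, Set.not_subset]
      rfl
    have hfm {Y : Type} [DefType L M Y] {g h : Y → M} (hg : DefMap L M g)
        (hh : DefMap L M h) : DefPred L M fun y => h y ∈ f (g y) :=
      .ex (.and (.le (by fun_prop) (by fun_prop))
        (.ex (hEm (by fun_prop) (by fun_prop) (by fun_prop))))
    have hfltm {Y : Type} [DefType L M Y] {g h : Y → M} (hg : DefMap L M g)
        (hh : DefMap L M h) : DefPred L M fun y => f (g y) < f (h y) := by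
      simp only [hflt]
      exact .ex (.and (hfm (by fun_prop) (by fun_prop)) (.not (hfm (by fun_prop) (by fun_prop))))
    obtain ⟨c, hpc, hcq, hc⟩ := exists_not_strictLocalMax (f := f)
      (fun c => DefPred.tame (L := L) (hfltm (by fun_prop) (by fun_prop)))
      (fun q => DefPred.tame (L := L) <| .all <| .imp (.lt (by fun_prop) (by fun_prop)) <|
        .imp (.lt (by fun_prop) (by fun_prop)) <| hfltm (by fun_prop) (by fun_prop))
      (fun q => DefPred.tame (L := L) <| .all <| .imp (.lt (by fun_prop) (by fun_prop)) <|
        .imp (.lt (by fun_prop) (by fun_prop)) <| hfltm (by fun_prop) (by fun_prop))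
      (DefPred.tame (L := L) <| .ex <| .ex <| .and (.lt (by fun_prop) (by fun_prop)) <|
        .and (.lt (by fun_prop) (by fun_prop)) <| .all <| .all <|
        .imp (.lt (by fun_prop) (by fun_prop)) <| .imp (.lt (by fun_prop) (by fun_prop)) <|
        .imp (.lt (by fun_prop) (by fun_prop)) <| .imp (.lt (by fun_prop) (by fun_prop)) <|
        hfltm (by fun_prop) (by fun_prop)) hpq
    refine hc ?_
    obtain ⟨x, u, hxu⟩ := hsub ⟨hpc.le, hcq.le⟩
    have hA : {d | ∃ y, E y d u}.Finite := by
      by_contra hinf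
      have ht : Tame {d | ∃ y, E y d u} := DefPred.tame (L := L) <|
        .ex (hEm (by fun_prop) (by fun_prop) (by fun_prop))
      obtain ⟨d, e, hde, hsub'⟩ := ht.exists_Icc_subset hinf
      obtain ⟨y, hy⟩ := hsub' ⟨hde.le, le_rfl⟩
      have : Nonempty X := ⟨x⟩
      have hsub'' : ∀ s ∈ Set.Icc d e, ∃ y, E y s u := fun s hs => hsub' hs
      choose! z hz using hsub''
      refine (Set.Icc_infinite hde) (Set.Finite.of_finite_image (f := fun s => T (z s))
        ((hIoo e u hy.1).subset ?_) ?_)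
      · rintro _ ⟨s, hs, rfl⟩
        exact ⟨z s, (Set.Ioo_subset_Ioo_left hs.2).trans (hz s hs).2.1, rfl⟩
      · intro s hs s' hs' heq
        exact hEu _ _ s s' u heq (hz s hs) (hz s' hs')
    have hAt : Tame {d | ∃ y, E y d u} := DefPred.tame (L := L) (DefPred.finite hA)
    obtain ⟨a, hac, ha⟩ := hAt.left_germ c
    obtain ⟨b, hcb, hb⟩ := hAt.right_germ c
    replace ha := ha.resolve_left fun h => Set.Ioo_infinite hac (hA.subset h)
    replace hb := hb.resolve_left fun h => Set.Ioo_infinite hcb (hA.subset h)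
    refine ⟨a, min b u, hac, lt_min hcb hxu.1, fun y hay hyb hne => (hflt y c).2 ⟨u, ?_, ?_⟩⟩
    · exact (hfmem hxu.1).2 ⟨x, hxu⟩
    · rw [hfmem (hyb.trans_le (min_le_right _ _))]
      rcases lt_or_gt_of_ne hne with h | h
      · exact ha ⟨hay, h⟩
      · exact hb ⟨h, hyb.trans_le (min_le_left _ _)⟩
  have hLE : (T '' {x | ∃ c u, E x c u}).Finite := by
    refine (hBfin.biUnion (t := fun c => T '' {x | ∃ u, E x c u}) fun c _ => ?_).subset ?_
    · refine finite_image_of_chain hT ?_ (K := Set.Ioo c) (D := Set.Ioi c) ?_ ?_ ?_ ?_ ?_ ?_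
      · exact .ex (hEm (by fun_prop) (by fun_prop) (by fun_prop))
      · exact .and (.lt (by fun_prop) (by fun_prop)) (.lt (by fun_prop) (by fun_prop))
      · exact fun a b => Set.Ioo_subset_Ioo_right
      · exact fun u hu v huv => lt_of_lt_of_le hu huv
      · exact fun u hu => (exists_between hu).imp fun v hv => hv
      · exact fun u hu => hIoo c u hu
      · exact fun x ⟨u, hu⟩ => ⟨u, hu.1, hu.2.1⟩
    · rintro _ ⟨x, ⟨c, u, h⟩, rfl⟩
      exact Set.mem_biUnion (x := c) ⟨x, u, h⟩ ⟨x, ⟨u, h⟩, rfl⟩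
  refine (hIio.union hLE).subset ?_
  rintro _ ⟨x, hx, rfl⟩
  have ht : Tame (T x) := DefPred.tame (L := L) (hTm (by fun_prop) (by fun_prop))
  rcases ht.exists_left_end hx with h | h
  · exact Or.inl ⟨x, h, rfl⟩
  · exact Or.inr ⟨x, h, rfl⟩

end Families

section Dimension

variable {L : FirstOrder.Language} {M : Type} [L.Structure M]

variable (M) in
/-- Iterated products of `M`. -/
def Pow : ℕ → Type
  | 0 => Unit
  | k + 1 => M × Pow k

instance Pow.defType : (k : ℕ) → DefType L M (Pow M k)
  | 0 => inferInstanceAs (DefType L M Unit)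
  | k + 1 => by
    have := Pow.defType k
    exact inferInstanceAs (DefType L M (M × Pow M k))

/-- The fibre of a set of pairs over its first coordinate. -/
def fib {X Y : Type} (s : Set (X × Y)) (t : X) : Set Y := {y | (t, y) ∈ s}

/-- The dimension of a subset of `M ^ k` is at least `n`. -/
def PowDimGE : (k n : ℕ) → Set (Pow M k) → Prop
  | 0, n, s => n = 0 ∧ s.Nonempty
  | k + 1, n, s => (∃ t : M, PowDimGE k n (fib s t)) ∨
      ∃ m, n = m + 1 ∧ {t : M | PowDimGE k m (fib s t)}.Infinite

theorem PowDimGE.mono {k n : ℕ} {s t : Set (Pow M k)} (h : PowDimGE k n s) (hst : s ⊆ t) :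
    PowDimGE k n t := by
  induction k generalizing n with
  | zero => exact ⟨h.1, h.2.mono hst⟩
  | succ k ih =>
    have hfib : ∀ u : M, fib s u ⊆ fib t u := fun u y hy => hst hy
    rcases h with ⟨u, h⟩ | ⟨m, rfl, h⟩
    · exact Or.inl ⟨u, ih h (hfib u)⟩
    · exact Or.inr ⟨m, rfl, h.mono fun u hu => ih hu (hfib u)⟩

theorem PowDimGE.nonempty {k n : ℕ} {s : Set (Pow M k)} (h : PowDimGE k n s) : s.Nonempty := by
  induction k generalizing n with
  | zero => exact h.2
  | succ k ih =>
    rcases h with ⟨u, h⟩ | ⟨m, rfl, h⟩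
    · obtain ⟨y, hy⟩ := ih h
      exact ⟨(u, y), hy⟩
    · obtain ⟨u, hu⟩ := h.nonempty
      obtain ⟨y, hy⟩ := ih hu
      exact ⟨(u, y), hy⟩

theorem powDimGE_zero {k : ℕ} {s : Set (Pow M k)} (h : s.Nonempty) : PowDimGE k 0 s := by
  induction k with
  | zero => exact ⟨rfl, h⟩
  | succ k ih =>
    obtain ⟨⟨u, y⟩, hy⟩ := h
    exact Or.inl ⟨u, ih ⟨y, hy⟩⟩

theorem PowDimGE.le {k n : ℕ} {s : Set (Pow M k)} (h : PowDimGE k n s) : n ≤ k := by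
  induction k generalizing n with
  | zero => exact h.1.le
  | succ k ih =>
    rcases h with ⟨u, h⟩ | ⟨m, rfl, h⟩
    · exact (ih h).trans k.le_succ
    · obtain ⟨u, hu⟩ := h.nonempty
      exact Nat.succ_le_succ (ih hu)

variable [LinearOrder M] [TameStructure L M] [DenselyOrdered M]

theorem DefPred.infinite {X : Type} [DefType L M X] {P : X → M → Prop}
    (hP : DefPred L M fun p : X × M => P p.1 p.2) :
    DefPred L M fun x => {t | P x t}.Infinite := by
  have h : DefPred L M fun x : X => ∃ a b, a < b ∧ ∀ t, a < t → t < b → P x t :=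
    .ex <| .ex <| .and (.lt (by fun_prop) (by fun_prop)) <| .all <|
      .imp (.lt (by fun_prop) (by fun_prop)) <| .imp (.lt (by fun_prop) (by fun_prop)) <|
      hP.comp₂ (by fun_prop) (by fun_prop)
  refine h.congr fun x => ⟨fun hinf => ?_, fun ⟨a, b, hab, hsub⟩ => ?_⟩
  · have ht : Tame {t | P x t} := DefPred.tame (L := L) (hP.comp₂ (by fun_prop) (by fun_prop))
    obtain ⟨a, b, hab, hsub⟩ := ht.exists_Icc_subset hinf
    exact ⟨a, b, hab, fun t h h' => hsub ⟨h.le, h'.le⟩⟩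
  · exact (Set.Ioo_infinite hab).mono fun t ht => hsub t ht.1 ht.2

theorem DefPred.powDimGE {X : Type} [DefType L M X] {k : ℕ} (n : ℕ) {s : X → Set (Pow M k)}
    (hs : DefPred L M fun p : X × Pow M k => p.2 ∈ s p.1) :
    DefPred L M fun x => PowDimGE k n (s x) := by
  induction k generalizing X n with
  | zero =>
    refine .and (.const _) (.ex ?_)
    exact hs
  | succ k ih =>
    have hfib : ∀ m, DefPred L M fun p : X × M => PowDimGE k m (fib (s p.1) p.2) := by
      intro m
      refine ih m ?_
      exact hs.comp₂ (Y := X) (Z := M × Pow M k) (P := fun x y => y ∈ s x)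
        (f := fun p : (X × M) × Pow M k => p.1.1) (g := fun p => (p.1.2, p.2))
        (by fun_prop) (by fun_prop)
    cases n with
    | zero =>
      exact (DefPred.ex (P := fun x t => PowDimGE k 0 (fib (s x) t)) (hfib 0)).congr fun x => by
        simp [PowDimGE]
    | succ n =>
      refine ((DefPred.ex (P := fun x t => PowDimGE k (n + 1) (fib (s x) t)) (hfib (n + 1))).or
        (DefPred.infinite (P := fun x t => PowDimGE k n (fib (s x) t)) (hfib n))).congr fun x => ?_
      simp [PowDimGE]

/-- A definable subset of `M ^ k` which meets infinitely many classes of a definable equivalence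
relation in sets of dimension at least `n` has dimension at least `n + 1`. -/
theorem powDimGE_succ [NoMinOrder M] [NoMaxOrder M] {k n : ℕ} {s : Set (Pow M k)}
    (hs : DefPred L M fun x => x ∈ s) {E : Pow M k → Pow M k → Prop} (hE : Equivalence E)
    (hEdef : DefPred L M fun p : Pow M k × Pow M k => E p.1 p.2) {ι : Type} [Infinite ι]
    (x : ι → Pow M k) (hx : ∀ i j, E (x i) (x j) → i = j)
    (hdim : ∀ i, PowDimGE k n (s ∩ {y | E (x i) y})) : PowDimGE k (n + 1) s := by
  induction k generalizing n ι with
  | zero =>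
    obtain ⟨i, j, hij⟩ := exists_pair_ne ι
    exact absurd (hx i j (hE.refl ())) hij
  | succ k ih =>
    change Set (M × Pow M k) at s
    change M × Pow M k → M × Pow M k → Prop at E
    have hfibre : ∀ (t : M) (m : ℕ) (κ : Type) [Infinite κ] (z : κ → M × Pow M k),
        (∀ i j, E (z i) (z j) → i = j) →
        (∀ i, PowDimGE k m (fib (s ∩ {y | E (z i) y}) t)) → PowDimGE k (m + 1) (fib s t) := by
      intro t m κ _ z hz hzdim
      choose w hw using fun i => (hzdim i).nonempty
      refine ih (E := fun y y' => E (t, y) (t, y')) ?_ ?_ ?_ w ?_ fun i => ?_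
      · exact hs.comp (f := fun y : Pow M k => ((t, y) : M × Pow M k)) (by fun_prop)
      · exact ⟨fun y => hE.refl _, fun h => hE.symm h, fun h h' => hE.trans h h'⟩
      · exact hEdef.comp₂ (Y := M × Pow M k) (Z := M × Pow M k) (P := fun y y' => E y y')
          (f := fun p : Pow M k × Pow M k => (t, p.1)) (g := fun p => (t, p.2))
          (by fun_prop) (by fun_prop)
      · intro i j hij
        exact hz i j (hE.trans (hw i).2 (hE.trans hij (hE.symm (hw j).2)))
      · exact (hzdim i).mono fun y hy => ⟨hy.1, hE.trans (hE.symm (hw i).2) hy.2⟩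
    by_contra hcon
    have hcon' : ∀ t, ¬ PowDimGE k (n + 1) (fib s t) := fun t ht => hcon (Or.inl ⟨t, ht⟩)
    have hS : {t : M | PowDimGE k n (fib s t)}.Finite := by
      by_contra hinf
      exact hcon (Or.inr ⟨n, rfl, hinf⟩)
    have hfin : ∀ t, {i | PowDimGE k n (fib (s ∩ {y | E (x i) y}) t)}.Finite := by
      intro t
      by_contra hinf
      have := Set.infinite_coe_iff.2 hinf
      exact hcon' t (hfibre t n ↥{i | PowDimGE k n (fib (s ∩ {y | E (x i) y}) t)}
        (fun i => x i) (fun i j hij => Subtype.ext (hx _ _ hij)) fun i => i.2)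
    have hI : {i | ∃ t, PowDimGE k n (fib (s ∩ {y | E (x i) y}) t)}.Finite := by
      refine (hS.biUnion fun t _ => hfin t).subset ?_
      rintro i ⟨t, ht⟩
      exact Set.mem_biUnion (x := t) (ht.mono fun y hy => hy.1) ht
    obtain ⟨i₀, hi₀⟩ := hI.exists_notMem
    obtain ⟨m, rfl, -⟩ := (hdim i₀).resolve_left hi₀
    let T : M × Pow M k → Set M := fun z => {t | PowDimGE k m (fib (s ∩ {y | E z y}) t)}
    have hT : DefPred L M fun p : (M × Pow M k) × M => p.2 ∈ T p.1 := by
      refine DefPred.powDimGE m (s := fun p : (M × Pow M k) × M => fib (s ∩ {y | E p.1 y}) p.2)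
        (.and ?_ ?_)
      · exact hs.comp (Y := M × Pow M k)
          (f := fun p : ((M × Pow M k) × M) × Pow M k => (p.1.2, p.2)) (by fun_prop)
      · exact hEdef.comp₂ (Y := M × Pow M k) (Z := M × Pow M k) (P := fun y y' => E y y')
          (f := fun p : ((M × Pow M k) × M) × Pow M k => p.1.1) (g := fun p => (p.1.2, p.2))
          (by fun_prop) (by fun_prop)
    have hTE : ∀ z z', E z z' → T z = T z' := by
      intro z z' hzz'
      have : {y | E z y} = {y | E z' y} :=
        Set.ext fun y => ⟨fun h => hE.trans (hE.symm hzz') h, fun h => hE.trans hzz' h⟩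
      simp only [T, this]
    have hTfin : (T '' {z | (T z).Infinite}).Finite := by
      refine finite_image_infinite hT hS fun t ht => ?_
      by_contra hinf
      have := Set.infinite_coe_iff.2 hinf
      choose z hz hzT using fun V : ↥(T '' {z | t ∈ T z}) => V.2
      refine ht (hfibre t m ↥(T '' {z | t ∈ T z}) z (fun V W hVW => Subtype.ext ?_) hz)
      rw [← hzT V, ← hzT W, hTE _ _ hVW]
    have hIinf : {i | ∃ t, PowDimGE k (m + 1) (fib (s ∩ {y | E (x i) y}) t)}ᶜ.Infinite :=
      hI.infinite_compl
    have hIT : ∀ i ∈ {i | ∃ t, PowDimGE k (m + 1) (fib (s ∩ {y | E (x i) y}) t)}ᶜ,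
        (T (x i)).Infinite := by
      intro i hi
      obtain ⟨m', hm', h⟩ := (hdim i).resolve_left hi
      obtain rfl : m = m' := Nat.succ_injective hm'
      exact h
    have := Set.infinite_coe_iff.2 hIinf
    have := hTfin.to_subtype
    let g (i : ↥{i | ∃ t, PowDimGE k (m + 1) (fib (s ∩ {y | E (x i) y}) t)}ᶜ) :
        ↥(T '' {z | (T z).Infinite}) := ⟨T (x i), x i, hIT i i.2, rfl⟩
    obtain ⟨V, hV⟩ := Finite.exists_infinite_fiber g
    have hVinf : V.1.Infinite := by
      obtain ⟨z, hz, hzV⟩ := V.2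
      exact hzV ▸ hz
    obtain ⟨t, htV, ht⟩ := hVinf.exists_notMem_finite hS
    refine ht (hfibre t m ↥(g ⁻¹' {V}) (fun i => x i.1.1) ?_ ?_)
    · exact fun i j hij => Subtype.ext (Subtype.ext (hx _ _ hij))
    · intro i
      have : T (x i.1.1) = V.1 := congrArg Subtype.val i.2
      change t ∈ T (x i.1.1)
      exact this ▸ htV

end Dimension

section Rank

variable (L : FirstOrder.Language) (M : Type) [L.Structure M]

/-- The rank of `s` is at least `n`: it meets infinitely many classes of a definable equivalence
relation in sets of rank at least `n - 1`. -/
def RkGE {X : Type} [DefType L M X] : ℕ → Set X → Prop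
  | 0, s => s.Nonempty
  | n + 1, s => ∃ E : X → X → Prop, Equivalence E ∧ DefPred L M (fun p : X × X => E p.1 p.2) ∧
      ∃ x : ℕ → X, (∀ i j, E (x i) (x j) → i = j) ∧ ∀ i, RkGE n (s ∩ {y | E (x i) y})

variable {L M} {X Y : Type} [DefType L M X] [DefType L M Y] {n : ℕ}

theorem RkGE.succ {s : Set X} {E : X → X → Prop} (hE : Equivalence E)
    (hEdef : DefPred L M fun p : X × X => E p.1 p.2) {ι : Type} [Infinite ι] (x : ι → X)
    (hx : ∀ i j, E (x i) (x j) → i = j) (h : ∀ i, RkGE L M n (s ∩ {y | E (x i) y})) :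
    RkGE L M (n + 1) s :=
  ⟨E, hE, hEdef, x ∘ Infinite.natEmbedding ι,
    fun _ _ hij => (Infinite.natEmbedding ι).injective (hx _ _ hij), fun _ => h _⟩

theorem RkGE.mono {s t : Set X} (h : RkGE L M n s) (hst : s ⊆ t) : RkGE L M n t := by
  induction n generalizing s t with
  | zero => exact Set.Nonempty.mono hst h
  | succ n ih =>
    obtain ⟨E, hE, hEdef, x, hx, h⟩ := h
    exact ⟨E, hE, hEdef, x, hx, fun i => ih (h i) (Set.inter_subset_inter_left _ hst)⟩

theorem RkGE.nonempty {s : Set X} (h : RkGE L M n s) : s.Nonempty := by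
  induction n generalizing s with
  | zero => exact h
  | succ n ih =>
    obtain ⟨E, hE, hEdef, x, hx, h⟩ := h
    exact (ih (h 0)).left

/-- Sets mapping onto a set of rank at least `n` have rank at least `n`. -/
theorem RkGE.of_subset_image {f : X → Y} (hf : DefMap L M f) {s : Set X} {t : Set Y}
    (h : RkGE L M n t) (hst : t ⊆ f '' s) : RkGE L M n s := by
  induction n generalizing s t with
  | zero =>
    obtain ⟨y, hy⟩ := h
    obtain ⟨x, hx, -⟩ := hst hy
    exact ⟨x, hx⟩
  | succ n ih =>
    obtain ⟨E, hE, hEdef, y, hy, h⟩ := h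
    choose z hz using fun i => (h i).nonempty
    choose x hx using fun i => hst (hz i).1
    refine ⟨fun a b => E (f a) (f b), ⟨fun _ => hE.refl _, hE.symm, hE.trans⟩,
      hEdef.comp₂ (by fun_prop) (by fun_prop), x, fun i j hij => ?_, fun i => ih (h i) ?_⟩
    · change E (f (x i)) (f (x j)) at hij
      rw [(hx i).2, (hx j).2] at hij
      exact hy i j (hE.trans (hz i).2 (hE.trans hij (hE.symm (hz j).2)))
    · rintro y' ⟨hy't, hy'⟩
      obtain ⟨x', hx's, rfl⟩ := hst hy't
      refine ⟨x', ⟨hx's, ?_⟩, rfl⟩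
      change E (f (x i)) (f x')
      rw [(hx i).2]
      exact hE.trans (hE.symm (hz i).2) hy'

theorem RkGE.union {s t : Set X} (h : RkGE L M n (s ∪ t)) : RkGE L M n s ∨ RkGE L M n t := by
  induction n generalizing s t with
  | zero => exact Set.union_nonempty.1 h
  | succ n ih =>
    obtain ⟨E, hE, hEdef, x, hx, h⟩ := h
    have h' : ∀ i, RkGE L M n (s ∩ {y | E (x i) y}) ∨ RkGE L M n (t ∩ {y | E (x i) y}) :=
      fun i => ih (Set.union_inter_distrib_right s t _ ▸ h i)
    rcases (Set.infinite_union (s := {i | RkGE L M n (s ∩ {y | E (x i) y})})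
      (t := {i | RkGE L M n (t ∩ {y | E (x i) y})})).1
      (Set.infinite_univ.mono fun i _ => h' i) with hi | hi
    · have := Set.infinite_coe_iff.2 hi
      exact Or.inl (.succ hE hEdef
        (fun i : ↥{i | RkGE L M n (s ∩ {y | E (x i) y})} => x i)
        (fun i j hij => Subtype.ext (hx _ _ hij)) fun i => i.2)
    · have := Set.infinite_coe_iff.2 hi
      exact Or.inr (.succ hE hEdef
        (fun i : ↥{i | RkGE L M n (t ∩ {y | E (x i) y})} => x i)
        (fun i j hij => Subtype.ext (hx _ _ hij)) fun i => i.2)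

theorem RkGE.biUnion {ι : Type} {I : Set ι} (hI : I.Finite) {s : ι → Set X} {t : Set X}
    (h : RkGE L M n t) (ht : t ⊆ ⋃ i ∈ I, s i) : ∃ i ∈ I, RkGE L M n (s i) := by
  induction I, hI using Set.Finite.induction_on generalizing t with
  | empty => simpa using (h.nonempty.mono ht)
  | @insert a J _ _ ih =>
    rw [Set.biUnion_insert] at ht
    rcases (h.mono ht).union with h | h
    · exact ⟨a, Set.mem_insert _ _, h⟩
    · obtain ⟨i, hi, h⟩ := ih h subset_rfl
      exact ⟨i, Set.mem_insert_of_mem _ hi, h⟩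

theorem rkGE_one {s : Set X} : RkGE L M 1 s ↔ s.Infinite := by
  constructor
  · rintro ⟨E, hE, hEdef, x, hx, h⟩
    choose y hy using h
    refine Set.infinite_of_injective_forall_mem (f := y) (fun i j hij => ?_) fun i => (hy i).1
    exact hx i j (hE.trans (hy i).2 (hij ▸ hE.symm (hy j).2))
  · intro h
    have := Set.infinite_coe_iff.2 h
    exact .succ (E := fun a b => a = b) eq_equivalence DefPred.eq_self (fun i : ↥s => (i : X))
      (fun i j => Subtype.ext) fun i => ⟨i, i.2, rfl⟩

/-- A set fibred over a set of rank at least `e`, with fibres of rank at least `d`, has rank at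
least `e + d`. -/
theorem RkGE.add {f : X → Y} (hf : DefMap L M f) {d e : ℕ} {s : Set X} {b : Set Y}
    (hb : RkGE L M e b) (hs : ∀ y ∈ b, RkGE L M d (s ∩ f ⁻¹' {y})) : RkGE L M (e + d) s := by
  induction e generalizing s b with
  | zero =>
    obtain ⟨y, hy⟩ := hb
    rw [Nat.zero_add]
    exact (hs y hy).mono Set.inter_subset_left
  | succ e ih =>
    obtain ⟨E, hE, hEdef, y, hy, hb⟩ := hb
    choose z hz using fun i => (hb i).nonempty
    choose x hx using fun i => (hs _ (hz i).1).nonempty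
    have hfx : ∀ i, f (x i) = z i := fun i => (hx i).2
    rw [Nat.add_right_comm]
    refine ⟨fun a b => E (f a) (f b), ⟨fun _ => hE.refl _, hE.symm, hE.trans⟩,
      hEdef.comp₂ (by fun_prop) (by fun_prop), x, fun i j hij => ?_, fun i => ih (hb i) ?_⟩
    · change E (f (x i)) (f (x j)) at hij
      rw [hfx, hfx] at hij
      exact hy i j (hE.trans (hz i).2 (hE.trans hij (hE.symm (hz j).2)))
    · rintro y' ⟨hy'b, hy'⟩
      refine (hs y' hy'b).mono fun x' hx' => ⟨⟨hx'.1, ?_⟩, hx'.2⟩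
      change E (f (x i)) (f x')
      rw [hfx, show f x' = y' from hx'.2]
      exact hE.trans (hE.symm (hz i).2) hy'

theorem exists_defMap_leftInvOn [Nonempty X] {f : X → Y} (hf : DefMap L M f) {s : Set X}
    (hs : DefPred L M (· ∈ s)) (hinj : Set.InjOn f s) :
    ∃ g : Y → X, DefMap L M g ∧ Set.LeftInvOn g f s := by
  classical
  refine ⟨Function.invFunOn f s, ?_, hinj.leftInvOn_invFunOn⟩
  have h : DefPred L M fun p : Y × X => (p.2 ∈ s ∧ f p.2 = p.1) ∨
      ((¬ ∃ x, x ∈ s ∧ f x = p.1) ∧ Classical.arbitrary X = p.2) :=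
    .or (.and (hs.comp (by fun_prop)) (.eq (by fun_prop) (by fun_prop)))
      (.and (.not (.ex (.and (hs.comp (by fun_prop)) (.eq (by fun_prop) (by fun_prop)))))
        (.eq (by fun_prop) (by fun_prop)))
  refine h.congr ?_
  rintro ⟨y, x⟩
  by_cases hy : ∃ x, x ∈ s ∧ f x = y
  · have hpos := Function.invFunOn_pos hy
    simp only [hy, not_true, false_and, or_false]
    constructor
    · rintro rfl
      exact hpos
    · rintro ⟨hx, hxy⟩
      exact hinj hpos.1 hx (hpos.2.trans hxy.symm)
  · have hneg := Function.invFunOn_neg hy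
    simp only [hy, not_false_eq_true, true_and, hneg]
    constructor
    · exact Or.inr
    · rintro (h | h)
      · exact absurd ⟨x, h⟩ hy
      · exact h

theorem RkGE.image {f : X → Y} (hf : DefMap L M f) {s t : Set X} (hs : DefPred L M (· ∈ s))
    (hinj : Set.InjOn f s) (hts : t ⊆ s) (h : RkGE L M n t) : RkGE L M n (f '' t) := by
  have : Nonempty X := h.nonempty.to_type
  obtain ⟨g, hg, hgf⟩ := exists_defMap_leftInvOn hf hs hinj
  refine h.of_subset_image hg fun x hx => ⟨f x, ⟨x, hx, rfl⟩, hgf (hts hx)⟩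

theorem RkGE.image_injective {f : X → Y} (hf : DefMap L M f) (hinj : Function.Injective f)
    {s : Set X} (h : RkGE L M n s) : RkGE L M n (f '' s) :=
  h.image hf (s := Set.univ) (.const True) hinj.injOn (Set.subset_univ _)

variable (L M X) in
theorem exists_defMap_pow : ∃ (k : ℕ) (f : X → Pow M k), DefMap L M f ∧ Function.Injective f := by
  have key : ∀ (k : ℕ) (c : Fin k → X → M), (∀ i, DefMap L M (c i)) →
      ∃ f : X → Pow M k, DefMap L M f ∧ ∀ x y, f x = f y → ∀ i, c i x = c i y := by
    intro k
    induction k with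
    | zero => exact fun c _ => ⟨fun _ => (), DefMap.const' (Y := Unit) (), fun _ _ _ i => i.elim0⟩
    | succ k ih =>
      intro c hc
      obtain ⟨f, hf, hfc⟩ := ih (fun i => c i.succ) fun i => hc _
      refine ⟨fun x => (c 0 x, f x), (hc 0).prodMk hf, fun x y hxy => Fin.cases ?_ ?_⟩
      · exact congrArg Prod.fst hxy
      · exact hfc x y (congrArg Prod.snd hxy)
  obtain ⟨k, ⟨σ⟩⟩ := Finite.exists_equiv_fin (DefType.ι L M X)
  obtain ⟨f, hf, hfc⟩ := key k (fun i x => DefType.emb (L := L) x (σ.symm i)) fun i =>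
    .of_reindex _ (fun _ => σ.symm i) fun _ _ => rfl
  refine ⟨k, f, hf, fun x y hxy => DefType.emb_injective (L := L) (M := M) (funext fun i => ?_)⟩
  simpa using hfc x y hxy (σ i)

theorem PowDimGE.rkGE {k : ℕ} {s : Set (Pow M k)} (h : PowDimGE k n s) : RkGE L M n s := by
  induction k generalizing n with
  | zero =>
    obtain ⟨rfl, h⟩ := h
    exact h
  | succ k ih =>
    have hfib : ∀ (t : M) (m : ℕ), PowDimGE k m (fib s t) →
        RkGE (X := M × Pow M k) L M m (s ∩ {y : M × Pow M k | t = y.1}) := by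
      intro t m h
      exact (ih h).of_subset_image (f := fun p : M × Pow M k => p.2) (by fun_prop)
        fun y hy => ⟨(t, y), ⟨hy, rfl⟩, rfl⟩
    rcases h with ⟨t, h⟩ | ⟨m, rfl, h⟩
    · exact (hfib t n h).mono (X := M × Pow M k) Set.inter_subset_left
    · have := Set.infinite_coe_iff.2 h
      have : Nonempty (Pow M k) := by
        obtain ⟨t, ht⟩ := h.nonempty
        exact ht.nonempty.to_type
      have y₀ : Pow M k := Classical.arbitrary _
      exact RkGE.succ (X := M × Pow M k) (E := fun a b => a.1 = b.1)
        ⟨fun _ => rfl, Eq.symm, Eq.trans⟩ (.eq (by fun_prop) (by fun_prop))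
        (fun t : ↥{t | PowDimGE k m (fib s t)} => (t.1, y₀)) (fun i j => Subtype.ext)
        fun t => hfib t m t.2

variable [LinearOrder M] [TameStructure L M] [DenselyOrdered M] [NoMinOrder M] [NoMaxOrder M]

theorem RkGE.powDimGE {k : ℕ} {s : Set (Pow M k)} (hs : DefPred L M (· ∈ s))
    (h : RkGE L M n s) : PowDimGE k n s := by
  induction n generalizing s with
  | zero => exact powDimGE_zero h
  | succ n ih =>
    obtain ⟨E, hE, hEdef, x, hx, h⟩ := h
    exact powDimGE_succ hs hE hEdef x hx fun i =>
      ih (hs.and (hEdef.comp₂ (by fun_prop) (by fun_prop))) (h i)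

variable (L M X) in
/-- Ranks in a definable set are bounded. -/
theorem exists_rkGE_le : ∃ k, ∀ n (s : Set X), RkGE L M n s → n ≤ k := by
  obtain ⟨k, f, hf, hinj⟩ := exists_defMap_pow L M X
  refine ⟨k, fun n s h => ?_⟩
  exact (((h.mono (Set.subset_univ s)).image_injective hf hinj).powDimGE (.ex
    (.and (.const True) (.eq (by fun_prop) (by fun_prop))))).le

theorem DefPred.rkGE (n : ℕ) {s : X → Set Y} (hs : DefPred L M fun p : X × Y => p.2 ∈ s p.1) :
    DefPred L M fun x => RkGE L M n (s x) := by
  obtain ⟨k, f, hf, hinj⟩ := exists_defMap_pow L M Y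
  have h : DefPred L M fun p : X × Pow M k => p.2 ∈ f '' s p.1 :=
    .ex (.and (hs.comp₂ (P := fun x y => y ∈ s x) (by fun_prop) (by fun_prop))
      (.eq (by fun_prop) (by fun_prop)))
  refine (DefPred.powDimGE n (s := fun x => f '' s x) h).congr fun x => ⟨fun hx => ?_, fun hx => ?_⟩
  · exact (hx.image_injective hf hinj).powDimGE
      (h.comp (f := fun y : Pow M k => (x, y)) (by fun_prop))
  · exact hx.rkGE.of_subset_image hf subset_rfl

theorem RkGE.cases_fibre {s : Set X} (hs : DefPred L M (· ∈ s)) {h : X → M} (hh : DefMap L M h)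
    (hn : RkGE L M n s) : (∃ t, RkGE L M n (s ∩ h ⁻¹' {t})) ∨
      ∃ m, n = m + 1 ∧ {t | RkGE L M m (s ∩ h ⁻¹' {t})}.Infinite := by
  obtain ⟨k, f, hf, hinj⟩ := exists_defMap_pow L M X
  have hg : DefMap L M fun x => (h x, f x) := by fun_prop
  have hdim : PowDimGE (k + 1) n ((fun x => (h x, f x)) '' s) := by
    refine RkGE.powDimGE (k := k + 1) ?_ (hn.image_injective (Y := M × Pow M k) hg
      fun x y hxy => hinj (congrArg Prod.snd hxy))
    exact DefPred.ex (X := M × Pow M k) (.and (hs.comp (by fun_prop))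
      (.eq (by fun_prop) (by fun_prop)))
  have hfib : ∀ t m, PowDimGE k m (fib ((fun x => (h x, f x)) '' s) t) →
      RkGE L M m (s ∩ h ⁻¹' {t}) := by
    intro t m hm
    refine hm.rkGE.of_subset_image hf ?_
    rintro y ⟨x, hx, hxy⟩
    exact ⟨x, ⟨hx, congrArg Prod.fst hxy⟩, congrArg Prod.snd hxy⟩
  rcases hdim with ⟨t, ht⟩ | ⟨m, hm, ht⟩
  · exact Or.inl ⟨t, hfib t n ht⟩
  · exact Or.inr ⟨m, hm, ht.mono fun t => hfib t m⟩

theorem RkGE.exists_fibre_pow {l : ℕ} {s : Set X} (hs : DefPred L M (· ∈ s)) {g : X → Pow M l}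
    (hg : DefMap L M g) (hn : RkGE L M n s) :
    ∃ d e, d + e = n ∧ RkGE L M e {y | RkGE L M d (s ∩ g ⁻¹' {y})} := by
  induction l generalizing n s with
  | zero => exact ⟨n, 0, rfl, (), hn.mono fun x hx => ⟨hx, rfl⟩⟩
  | succ l ih =>
    change X → M × Pow M l at g
    change DefMap (Y := M × Pow M l) L M g at hg
    have hst : ∀ t, DefPred L M (· ∈ s ∩ (fun x => (g x).1) ⁻¹' {t}) := fun t =>
      hs.and (.eq (by fun_prop) (by fun_prop))
    have hsub : ∀ t d, (fun y : Pow M l => (t, y)) ''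
        {y | RkGE L M d (s ∩ (fun x => (g x).1) ⁻¹' {t} ∩ (fun x => (g x).2) ⁻¹' {y})} ⊆
          {y | RkGE L M d (s ∩ g ⁻¹' {y})} ∩ Prod.fst ⁻¹' {t} := by
      rintro t d _ ⟨y, hy, rfl⟩
      exact ⟨RkGE.mono hy fun x hx => ⟨hx.1.1, Prod.ext hx.1.2 hx.2⟩, rfl⟩
    have himg : ∀ t {e} {b : Set (Pow M l)}, RkGE L M e b →
        RkGE L M e ((fun y : Pow M l => (t, y)) '' b) := fun t e b hb =>
      hb.image_injective (Y := M × Pow M l) (.prodMk (.const' t) .id')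
        fun y y' h => congrArg Prod.snd h
    rcases hn.cases_fibre hs (h := fun x => (g x).1) (by fun_prop) with ⟨t, ht⟩ | ⟨m, rfl, ht⟩
    · obtain ⟨d, e, hde, h⟩ := ih (hst t) (g := fun x => (g x).2) (by fun_prop) ht
      exact ⟨d, e, hde, (himg t h).mono ((hsub t d).trans Set.inter_subset_left)⟩
    · have hcov : {t | RkGE L M m (s ∩ (fun x => (g x).1) ⁻¹' {t})} ⊆ ⋃ d ∈ Set.Iic m,
          {t | RkGE L M (m - d) {y | RkGE L M d
            (s ∩ (fun x => (g x).1) ⁻¹' {t} ∩ (fun x => (g x).2) ⁻¹' {y})}} := by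
        intro t ht
        obtain ⟨d, e, rfl, h⟩ := ih (hst t) (g := fun x => (g x).2) (by fun_prop) ht
        exact Set.mem_biUnion (x := d) (Nat.le_add_right d e)
          ((Nat.add_sub_cancel_left d e).symm ▸ h)
      obtain ⟨d, hd, h⟩ := ((rkGE_one (L := L) (M := M)).2 ht).biUnion (Set.finite_Iic m) hcov
      have hd : d ≤ m := hd
      refine ⟨d, 1 + (m - d), by omega, RkGE.add (X := M × Pow M l) DefMap.fst' h ?_⟩
      exact fun t ht => (himg t ht).mono (hsub t d)

theorem RkGE.exists_fibre {s : Set X} (hs : DefPred L M (· ∈ s)) {g : X → Y}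
    (hg : DefMap L M g) (hn : RkGE L M n s) :
    ∃ d e, d + e = n ∧ RkGE L M e {y | RkGE L M d (s ∩ g ⁻¹' {y})} := by
  obtain ⟨l, f, hf, hinj⟩ := exists_defMap_pow L M Y
  obtain ⟨d, e, hde, h⟩ := hn.exists_fibre_pow hs (g := fun x => f (g x)) (by fun_prop)
  refine ⟨d, e, hde, h.of_subset_image hf fun z hz => ?_⟩
  obtain ⟨x, -, hx⟩ := RkGE.nonempty hz
  refine ⟨g x, RkGE.mono hz fun x' hx' => ⟨hx'.1, hinj ?_⟩, hx⟩
  exact hx'.2.trans hx.symm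

end Rank

section LeftIdeals

variable {A : Type} [NonUnitalRing A]

/-- The left multiples of `x`. -/
def leftMul (x : A) : AddSubgroup A := (AddMonoidHom.mulRight x).range

theorem mem_leftMul {x y : A} : y ∈ leftMul x ↔ ∃ r, r * x = y := Iff.rfl

theorem mul_mem_leftMul (r x : A) : r * x ∈ leftMul x := ⟨r, rfl⟩

theorem leftMul_mul_mem {x y : A} (h : y ∈ leftMul x) (r : A) : r * y ∈ leftMul x := by
  obtain ⟨s, rfl⟩ := h
  exact ⟨r * s, mul_assoc r s x⟩

theorem leftMul_le {x y : A} (h : y ∈ leftMul x) : leftMul y ≤ leftMul x := by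
  rintro _ ⟨r, rfl⟩
  exact leftMul_mul_mem h r

/-- `I` is a left ideal which is generated by each of its nonzero elements. -/
def MinLeft (I : AddSubgroup A) : Prop :=
  I ≠ ⊥ ∧ (∀ r, ∀ x ∈ I, r * x ∈ I) ∧ ∀ y ∈ I, y ≠ 0 → I ≤ leftMul y

/-- The element form of being a semiprime ring. -/
def Semiprime (A : Type) [NonUnitalRing A] : Prop := ∀ a : A, (∀ r, a * r * a = 0) → a = 0

theorem Semiprime.eq_zero (hsp : Semiprime A) {x : A} (h : ∀ r, r * x = 0) : x = 0 :=
  hsp x fun r => by rw [mul_assoc, h, mul_zero]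

theorem Semiprime.leftMul_ne_bot (hsp : Semiprime A) {x : A} (hx : x ≠ 0) : leftMul x ≠ ⊥ := by
  intro h
  refine hx (hsp.eq_zero fun r => ?_)
  have : r * x ∈ leftMul x := mul_mem_leftMul r x
  rwa [h, AddSubgroup.mem_bot] at this

theorem Semiprime.minLeft_leftMul (hsp : Semiprime A) {x : A} (hx : x ≠ 0)
    (h : ∀ y ∈ leftMul x, y ≠ 0 → leftMul x ≤ leftMul y) : MinLeft (leftMul x) :=
  ⟨hsp.leftMul_ne_bot hx, fun r _ hy => leftMul_mul_mem hy r, h⟩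

/-- A nonzero element of a left ideal does not annihilate the left ideal. -/
theorem Semiprime.exists_mul_ne_zero (hsp : Semiprime A) {I : AddSubgroup A}
    (hI : ∀ r, ∀ x ∈ I, r * x ∈ I) {z : A} (hz : z ∈ I) (hz0 : z ≠ 0) : ∃ b ∈ I, z * b ≠ 0 := by
  by_contra! h
  exact hz0 (hsp z fun r => by rw [mul_assoc]; exact h _ (hI r z hz))

/-- A minimal left ideal of a semiprime ring is generated by an idempotent. -/
theorem MinLeft.exists_idempotent (hsp : Semiprime A) {I : AddSubgroup A} (hI : MinLeft I) :
    ∃ e ∈ I, e * e = e ∧ e ≠ 0 ∧ I = leftMul e := by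
  obtain ⟨hne, hleft, hmin⟩ := hI
  obtain ⟨z, hz, hz0⟩ := I.bot_or_exists_ne_zero.resolve_left hne
  obtain ⟨b, hb, hzb⟩ := hsp.exists_mul_ne_zero hleft hz hz0
  have hb0 : b ≠ 0 := by
    rintro rfl
    exact hzb (mul_zero _)
  obtain ⟨r, hr⟩ := hmin _ (hleft _ _ hb) hzb hb
  have heb : r * z * b = b := (mul_assoc _ _ _).trans hr
  have heI : r * z ∈ I := hleft _ _ hz
  have he0 : r * z ≠ 0 := by
    intro h
    rw [h, zero_mul] at heb
    exact hb0 heb.symm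
  refine ⟨r * z, heI, ?_, he0, le_antisymm (hmin _ heI he0) ?_⟩
  · by_contra hne
    obtain ⟨s, hs⟩ := hmin (r * z * (r * z) - r * z) (I.sub_mem (hleft _ _ heI) heI)
      (sub_ne_zero.2 hne) hz
    refine hzb ?_
    rw [← hs]
    change s * (r * z * (r * z) - r * z) * b = 0
    rw [mul_assoc, sub_mul, mul_assoc (r * z), heb, heb, sub_self, mul_zero]
  · rintro _ ⟨s, rfl⟩
    exact hleft _ _ heI

theorem MinLeft.primitive {e f g : A} (he : MinLeft (leftMul e)) (hee : e * e = e)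
    (hf : f * f = f) (hf0 : f ≠ 0) (hfg : f * g = 0) (hgf : g * f = 0) (heq : e = f + g) :
    g = 0 := by
  have hfe : f * e = f := by rw [heq, mul_add, hf, hfg, add_zero]
  have hef : e * f = f := by rw [heq, add_mul, hf, hgf, add_zero]
  obtain ⟨r, hr⟩ := he.2.2 f ⟨f, hfe⟩ hf0 (x := e) ⟨e, hee⟩
  replace hr : r * f = e := hr
  have h : e = f := by rw [← hef, ← hr, mul_assoc, hf]
  simpa [heq] using h

end LeftIdeals

section Minimal

variable (L : FirstOrder.Language) (M : Type) [L.Structure M]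

/-- A ring with definable operations. -/
class RingDef (A : Type) [NonUnitalRing A] [DefType L M A] : Prop where
  add_def : DefMap L M fun p : A × A => p.1 + p.2
  mul_def : DefMap L M fun p : A × A => p.1 * p.2

variable {L M} {A X : Type} [NonUnitalRing A] [DefType L M A] [RingDef L M A] [DefType L M X]

@[fun_prop]
theorem DefMap.add {f g : X → A} (hf : DefMap L M f) (hg : DefMap L M g) :
    DefMap L M fun x => f x + g x :=
  (RingDef.add_def (L := L) (M := M) (A := A)).comp' (hf.prodMk hg)

@[fun_prop]
theorem DefMap.mul {f g : X → A} (hf : DefMap L M f) (hg : DefMap L M g) :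
    DefMap L M fun x => f x * g x :=
  (RingDef.mul_def (L := L) (M := M) (A := A)).comp' (hf.prodMk hg)

@[fun_prop]
theorem DefMap.neg {f : X → A} (hf : DefMap L M f) : DefMap L M fun x => -f x := by
  have h : DefPred L M fun p : X × A => f p.1 + p.2 = 0 := .eq (by fun_prop) (by fun_prop)
  exact h.congr fun p => neg_eq_iff_add_eq_zero

theorem DefPred.mem_leftMul {f g : X → A} (hf : DefMap L M f) (hg : DefMap L M g) :
    DefPred L M fun x => f x ∈ leftMul (g x) :=
  .ex (P := fun x r => r * g x = f x) (.eq (by fun_prop) (by fun_prop))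

variable {n : ℕ}

theorem RkGE.translate {s : Set A} (h : RkGE L M n s) (a : A) :
    RkGE L M n ((fun x => a + x) '' s) :=
  h.image_injective (by fun_prop) (add_right_injective a)

theorem RkGE.of_succ {Y : Type} [DefType L M Y] {s : Set Y} (h : RkGE L M (n + 1) s) :
    RkGE L M n s := by
  obtain ⟨E, hE, hEdef, x, hx, h⟩ := h
  exact (h 0).mono Set.inter_subset_left

theorem RkGE.of_le {Y : Type} [DefType L M Y] {m : ℕ} {s : Set Y} (h : RkGE L M n s)
    (hmn : m ≤ n) : RkGE L M m s := by
  induction n, hmn using Nat.le_induction with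
  | base => exact h
  | succ k _ ih => exact ih h.of_succ

/-- A subgroup of full rank has finite index. -/
theorem exists_finset_cosets {H I : AddSubgroup A} (hH : DefPred L M (· ∈ H)) (hHI : H ≤ I)
    (h : RkGE L M n (H : Set A)) (hI : ¬ RkGE L M (n + 1) (I : Set A)) :
    ∃ Q : Finset A, (∀ q ∈ Q, q ∈ I) ∧ ∀ y ∈ I, ∃ q ∈ Q, -q + y ∈ H := by
  by_contra! hcon
  obtain ⟨x, hxI, hx⟩ := exists_seq_of_forall_finset_exists (· ∈ I) (fun q y => -q + y ∉ H) hcon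
  refine hI (RkGE.succ (E := fun a b => -a + b ∈ H) ⟨fun a => ?_, fun {a b} hab => ?_,
    fun {a b c} hab hbc => ?_⟩ ?_ x (fun i j hij => ?_) fun i => ?_)
  · simp [H.zero_mem]
  · simpa using H.neg_mem hab
  · simpa [add_assoc] using H.add_mem hab hbc
  · exact hH.comp (by fun_prop)
  · by_contra hne
    rcases lt_or_gt_of_ne hne with hlt | hlt
    · exact hx i j hlt hij
    · exact hx j i hlt (by simpa using H.neg_mem hij)
  · refine (h.translate (x i)).mono ?_
    rintro _ ⟨y, hy, rfl⟩
    exact ⟨I.add_mem (hxI i) (hHI hy), by simpa using hy⟩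

/-- A group of rank at most the rank of the kernel of a homomorphism has finite image. -/
theorem finite_image_of_ker {I : AddSubgroup A} (b : A)
    (h : RkGE L M n {x | x ∈ I ∧ x * b = 0}) (hI : ¬ RkGE L M (n + 1) (I : Set A)) :
    ((· * b) '' (I : Set A)).Finite := by
  by_contra hinf
  refine hI ?_
  rw [add_comm]
  refine RkGE.add (f := (· * b)) (by fun_prop) (rkGE_one.2 hinf) ?_
  rintro _ ⟨x, hx, rfl⟩
  refine (h.translate x).mono ?_
  rintro _ ⟨y, hy, rfl⟩
  refine ⟨I.add_mem hx hy.1, ?_⟩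
  simp [add_mul, hy.2]

/-- The kernel of a homomorphism with finite image has full rank. -/
theorem RkGE.ker {I : AddSubgroup A} (b : A) (h : RkGE L M n (I : Set A))
    (hfin : ((· * b) '' (I : Set A)).Finite) : RkGE L M n {x | x ∈ I ∧ x * b = 0} := by
  obtain ⟨_, ⟨x, hx, rfl⟩, h⟩ := h.biUnion hfin (s := fun z => {y | y ∈ I ∧ y * b = z})
    fun y hy => Set.mem_biUnion (x := y * b) ⟨y, hy, rfl⟩ ⟨hy, rfl⟩
  refine (h.translate (-x)).mono ?_
  rintro _ ⟨y, hy, rfl⟩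
  refine ⟨I.add_mem (I.neg_mem hx) hy.1, ?_⟩
  have : y * b = x * b := hy.2
  simp [add_mul, this]

theorem Semiprime.exists_minLeft_of_finite (hsp : Semiprime A) {x : A} (hx : x ≠ 0)
    (hfin : (leftMul x : Set A).Finite) : ∃ I ≤ leftMul x, MinLeft I := by
  induction hk : (leftMul x : Set A).ncard using Nat.strong_induction_on generalizing x with
  | _ k ih =>
    by_cases h : ∀ y ∈ leftMul x, y ≠ 0 → leftMul x ≤ leftMul y
    · exact ⟨_, le_rfl, hsp.minLeft_leftMul hx h⟩
    · push Not at h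
      obtain ⟨y, hy, hy0, hxy⟩ := h
      have hlt : (leftMul y : Set A) ⊂ leftMul x := ⟨leftMul_le hy, hxy⟩
      obtain ⟨I, hI, hmin⟩ := ih _ (hk ▸ Set.ncard_lt_ncard hlt hfin) hy0
        (hfin.subset hlt.1) rfl
      exact ⟨I, hI.trans (leftMul_le hy), hmin⟩

variable [LinearOrder M] [TameStructure L M] [DenselyOrdered M] [NoMinOrder M] [NoMaxOrder M]

theorem Semiprime.exists_minLeft_of_rank (hsp : Semiprime A) {x : A} (hx : x ≠ 0)
    (hn : ¬ RkGE L M (n + 2) (leftMul x : Set A))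
    (hall : ∀ y ∈ leftMul x, y ≠ 0 → RkGE L M (n + 1) (leftMul y : Set A)) :
    ∃ I ≤ leftMul x, MinLeft I := by
  set I := leftMul x with hIdef
  have hI : ∀ r, ∀ y ∈ I, r * y ∈ I := fun r y hy => leftMul_mul_mem hy r
  have hIle : ∀ y ∈ I, leftMul y ≤ I := fun y hy => leftMul_le hy
  have hIpred : DefPred L M fun y => y ∈ I := .mem_leftMul (by fun_prop) (by fun_prop)
  have hIinf : ∀ y ∈ I, y ≠ 0 → (leftMul y : Set A).Infinite := fun y hy hy0 =>
    rkGE_one.1 ((hall y hy hy0).of_le (Nat.le_add_left 1 n))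
  -- right multiplication by `b` is either zero or injective on `I`
  have hinj : ∀ b ∈ I, (∃ c ∈ I, c * b ≠ 0) → ∀ c ∈ I, c * b = 0 → c = 0 := by
    rintro b hb ⟨c, hc, hcb⟩ k hk hkb
    by_contra hk0
    have hker : RkGE L M (n + 1) {y | y ∈ I ∧ y * b = 0} := by
      refine (hall k hk hk0).mono ?_
      rintro _ ⟨r, rfl⟩
      refine ⟨hI r k hk, ?_⟩
      change r * k * b = 0
      rw [mul_assoc, hkb, mul_zero]
    refine hIinf (c * b) (hI c b hb) hcb ((finite_image_of_ker b hker hn).subset ?_)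
    rintro _ ⟨r, rfl⟩
    exact ⟨r * c, hI r c hc, mul_assoc r c b⟩
  let S : Set A := {b | b ∈ I ∧ ∃ c ∈ I, c * b ≠ 0}
  have hcancel : ∀ b ∈ S, Set.InjOn (· * b) (I : Set A) := by
    intro b hb c hc d hd hcd
    refine sub_eq_zero.1 (hinj b hb.1 hb.2 _ (I.sub_mem hc hd) ?_)
    rw [sub_mul]
    exact sub_eq_zero.2 hcd
  have hSne : ∀ b ∈ S, b ≠ 0 := by
    rintro b ⟨-, c, -, hc⟩ rfl
    exact hc (mul_zero c)
  have hmulS : ∀ b ∈ S, ∀ c ∈ S, b * c ∈ S := by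
    rintro b ⟨hb, d, hd, hdb⟩ c hc
    refine ⟨hI b c hc.1, d, hd, fun h => hdb ?_⟩
    rw [← mul_assoc] at h
    exact hinj c hc.1 hc.2 _ (hI d b hb) h
  have hzero : ¬ RkGE L M (n + 1) ({0} : Set A) := fun h =>
    rkGE_one.1 (h.of_le (Nat.le_add_left 1 n)) (Set.finite_singleton 0)
  obtain ⟨z₀, hz₀, hz₀0⟩ := I.bot_or_exists_ne_zero.resolve_left (hsp.leftMul_ne_bot hx)
  have hIrk : RkGE L M (n + 1) (I : Set A) := (hall z₀ hz₀ hz₀0).mono (hIle z₀ hz₀)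
  have hI0rk : RkGE L M (n + 1) {c | c ∈ I ∧ c ≠ 0} := by
    refine (RkGE.union (t := {0}) (hIrk.mono fun c hc => ?_)).resolve_right hzero
    by_cases h : c = 0
    · exact Or.inr h
    · exact Or.inl ⟨hc, h⟩
  have hSrk : RkGE L M (n + 1) S := by
    obtain ⟨b₀, hb₀, hzb₀⟩ := hsp.exists_mul_ne_zero hI hz₀ hz₀0
    have hcov : (I : Set A) ⊆ S ∪ {b | b ∈ I ∧ ∀ c ∈ I, c * b = 0} := by
      intro b hb
      by_cases h : ∃ c ∈ I, c * b ≠ 0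
      · exact Or.inl ⟨hb, h⟩
      · push Not at h
        exact Or.inr ⟨hb, h⟩
    refine (hIrk.mono hcov).union.elim id fun h => (h.translate b₀).mono ?_
    rintro _ ⟨b, hb, rfl⟩
    refine ⟨I.add_mem hb₀ hb.1, z₀, hz₀, ?_⟩
    rwa [mul_add, hb.2 z₀ hz₀, add_zero]
  have hSpred : DefPred L M (· ∈ S) := hIpred.and <| .ex (P := fun b c => c ∈ I ∧ c * b ≠ 0) <|
    .and (hIpred.comp (by fun_prop)) (.not (.eq (by fun_prop) (by fun_prop)))
  let W : Set (A × A) := {p | p.1 ∈ S ∧ ∃ c, (c ∈ I ∧ c ≠ 0) ∧ c * p.1 = p.2}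
  have hWpred : DefPred L M (· ∈ W) := .and (hSpred.comp (by fun_prop)) <|
    .ex (P := fun (p : A × A) c => (c ∈ I ∧ c ≠ 0) ∧ c * p.1 = p.2) <|
    .and (.and (hIpred.comp (by fun_prop)) (.not (.eq (by fun_prop) (by fun_prop))))
      (.eq (by fun_prop) (by fun_prop))
  have hWrk : RkGE L M ((n + 1) + (n + 1)) W := by
    refine RkGE.add (f := Prod.fst) DefMap.fst' hSrk fun b hb => ?_
    refine (hI0rk.image (f := fun c => (b, c * b)) (s := (I : Set A)) (by fun_prop) hIpred
      (fun c hc d hd hcd => hcancel b hb hc hd (congrArg Prod.snd hcd)) fun c hc => hc.1).mono ?_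
    rintro _ ⟨c, hc, rfl⟩
    exact ⟨⟨hb, c, hc, rfl⟩, rfl⟩
  have hWI : ∀ p ∈ W, p.1 ∈ I ∧ p.2 ∈ I ∧ p.2 ≠ 0 := by
    rintro ⟨b, y⟩ ⟨hb, c, ⟨hc, hc0⟩, hcy⟩
    obtain rfl : c * b = y := hcy
    exact ⟨hb.1, hI c b hb.1, fun h => hc0 (hinj b hb.1 hb.2 c hc h)⟩
  obtain ⟨y₀, hy₀, hy₀0, hDrk⟩ : ∃ y₀ ∈ I, y₀ ≠ 0 ∧
      RkGE L M (n + 1) {b | b ∈ S ∧ ∃ c ∈ I, c * b = y₀} := by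
    obtain ⟨d, e, hde, h⟩ := hWrk.exists_fibre hWpred DefMap.snd'
    have he : e ≤ n + 1 := by
      by_contra hlt
      refine hn (RkGE.of_le (h.mono fun y hy => ?_) (by omega : n + 2 ≤ e))
      obtain ⟨p, hp, hpy⟩ := RkGE.nonempty hy
      exact hpy ▸ (hWI p hp).2.1
    obtain ⟨y₀, hy₀⟩ := h.nonempty
    have hd : d ≤ n + 1 := by
      by_contra hlt
      have himg := RkGE.image (f := Prod.fst) DefMap.fst' (s := {p : A × A | p.2 = y₀})
        (.eq (by fun_prop) (by fun_prop))
        (fun p hp q hq hpq => Prod.ext hpq (hp.trans hq.symm)) (fun p hp => hp.2) hy₀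
      refine hn (RkGE.of_le (himg.mono ?_) (by omega : n + 2 ≤ d))
      rintro _ ⟨p, hp, rfl⟩
      exact (hWI p hp.1).1
    obtain rfl : d = n + 1 := by omega
    obtain ⟨p, hp, rfl⟩ := RkGE.nonempty hy₀
    refine ⟨p.2, (hWI p hp).2.1, (hWI p hp).2.2, ?_⟩
    have himg := RkGE.image (f := Prod.fst) DefMap.fst' (s := {q : A × A | q.2 = p.2})
      (.eq (by fun_prop) (by fun_prop))
      (fun q hq q' hq' hqq => Prod.ext hqq (hq.trans hq'.symm)) (fun q hq => hq.2) hy₀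
    refine himg.mono ?_
    rintro _ ⟨q, ⟨⟨hq, c, hc, hcq⟩, hqp⟩, rfl⟩
    exact ⟨hq, c, hc.1, hcq.trans hqp⟩
  let im (b : A) : AddSubgroup A := I.map (AddMonoidHom.mulRight b)
  have him : ∀ b ∈ I, im b ≤ I := by
    rintro b hb _ ⟨c, hc, rfl⟩
    exact hI c b hb
  obtain ⟨C, hCS, hCrk, hCim⟩ : ∃ C ⊆ S, RkGE L M (n + 1) C ∧ ∀ b ∈ C, ∀ b' ∈ C, im b = im b' := by
    obtain ⟨Q, hQI, hQ⟩ := exists_finset_cosets (.mem_leftMul (by fun_prop) (by fun_prop))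
      (hIle y₀ hy₀) (hall y₀ hy₀ hy₀0) hn
    obtain ⟨T, -, hT⟩ := hDrk.biUnion (I := {T : Finset A | T ⊆ Q})
      (s := fun T => {b | (b ∈ S ∧ y₀ ∈ im b) ∧ ∀ q ∈ Q, q ∈ im b ↔ q ∈ T})
      ((Finset.finite_toSet Q.powerset).subset fun T hT => by simpa using hT) (by
        classical
        intro b hb
        refine Set.mem_biUnion (x := Q.filter (· ∈ im b)) (Finset.filter_subset _ _) ⟨hb, ?_⟩
        intro q hq
        simp [hq])
    refine ⟨_, fun b hb => hb.1.1, hT, ?_⟩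
    have hle : ∀ b b', (b ∈ S ∧ y₀ ∈ im b) ∧ (∀ q ∈ Q, q ∈ im b ↔ q ∈ T) →
        (b' ∈ S ∧ y₀ ∈ im b') ∧ (∀ q ∈ Q, q ∈ im b' ↔ q ∈ T) → im b ≤ im b' := by
      rintro b b' ⟨⟨hbS, hb⟩, hbT⟩ ⟨⟨hbS', hb'⟩, hbT'⟩ y hy
      have hsub : ∀ a, y₀ ∈ im a → leftMul y₀ ≤ im a := by
        rintro a ⟨c, hc, hca⟩ _ ⟨r, rfl⟩
        exact ⟨r * c, hI r c hc, by rw [← hca]; exact mul_assoc r c a⟩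
      obtain ⟨q, hq, hqy⟩ := hQ y (him b hbS.1 hy)
      have hqb : q ∈ im b := by
        have := (im b).sub_mem hy (hsub b hb hqy)
        simpa using this
      have hqb' : q ∈ im b' := (hbT' q hq).2 ((hbT q hq).1 hqb)
      have := (im b').add_mem hqb' (hsub b' hb' hqy)
      simpa using this
    exact fun b hb b' hb' => le_antisymm (hle b b' hb hb') (hle b' b hb' hb)
  obtain ⟨b, hbC⟩ := hCrk.nonempty
  have hbS := hCS hbC
  have hbI := hbS.1
  have hyI : b * b ∈ I := hI b b hbI
  have hy0 : b * b ≠ 0 := hSne _ (hmulS b hbS b hbS)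
  by_cases hcase : ∀ z ∈ S, b * b ∈ im z
  · refine ⟨leftMul (b * b), hIle _ hyI, hsp.minLeft_leftMul hy0 fun w hw hw0 => leftMul_le ?_⟩
    have hwI : w ∈ I := hIle _ hyI hw
    obtain ⟨r, hr⟩ : ∃ r, r * w ∈ S := by
      by_contra! h
      refine hw0 (hsp w fun r => ?_)
      by_contra hne
      exact h r ⟨hI r w hwI, w, hwI, by rwa [← mul_assoc]⟩
    obtain ⟨c, -, hc⟩ := hcase _ hr
    exact ⟨c * r, (mul_assoc c r w).trans hc⟩
  · push Not at hcase
    obtain ⟨z, hz, hyz⟩ := hcase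
    exfalso
    let φ (k : ℕ) : A → A := (· * z)^[k]
    have hφs : ∀ k a, φ (k + 1) a = φ k a * z := fun k a => Function.iterate_succ_apply' _ k a
    have hφdef : ∀ k, DefMap L M (φ k) := by
      intro k
      induction k with
      | zero => exact DefMap.id'
      | succ k ih =>
        rw [show φ (k + 1) = fun a => φ k a * z from funext (hφs k)]
        fun_prop
    have hφS : ∀ k, ∀ a ∈ S, φ k a ∈ S := by
      intro k a ha
      induction k with
      | zero => exact ha
      | succ k ih => exact hφs k a ▸ hmulS _ ih z hz
    have hφI : ∀ k, ∀ a ∈ I, φ k a ∈ I := by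
      intro k a ha
      induction k with
      | zero => exact ha
      | succ k ih => exact hφs k a ▸ hI _ z hz.1
    have hφinj : ∀ k, Set.InjOn (φ k) (I : Set A) := by
      intro k a ha a' ha' h
      induction k with
      | zero => exact h
      | succ k ih =>
        rw [hφs, hφs] at h
        exact ih (hcancel z hz (hφI k a ha) (hφI k a' ha') h)
    have hφmul : ∀ k c a, φ k (c * a) = c * φ k a := by
      intro k c a
      induction k with
      | zero => rfl
      | succ k ih => rw [hφs, hφs, ih, mul_assoc]
    have hφim : ∀ k a v, v ∈ im (φ k a) ↔ ∃ u ∈ im a, φ k u = v := by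
      intro k a v
      constructor
      · rintro ⟨c, hc, rfl⟩
        exact ⟨c * a, ⟨c, hc, rfl⟩, hφmul k c a⟩
      · rintro ⟨_, ⟨c, hc, rfl⟩, rfl⟩
        exact ⟨c, hc, (hφmul k c a).symm⟩
    have hdistinct : ∀ k l, k < l → im (φ k b) ≠ im (φ l b) := by
      intro k l hkl h
      obtain ⟨j, rfl⟩ := Nat.exists_eq_add_of_lt hkl
      have hmem : φ k (b * b) ∈ im (φ (k + j + 1) b) := h ▸ ⟨b, hbI, (hφmul k b b).symm⟩
      obtain ⟨c, hc, hcb⟩ := hmem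
      have hcb' : c * φ (k + j + 1) b = φ k (b * b) := hcb
      rw [← hφmul, Nat.add_assoc, show φ (k + (j + 1)) (c * b) = φ k (φ (j + 1) (c * b)) from
        Function.iterate_add_apply _ k (j + 1) _] at hcb'
      have heq := hφinj k (hφI _ _ (hI c b hbI)) hyI hcb'
      exact hyz ⟨φ j (c * b), hφI j _ (hI c b hbI), (hφs j _).symm.trans heq⟩
    refine hn (RkGE.succ (E := fun a a' => im a = im a') ⟨fun _ => rfl, Eq.symm, Eq.trans⟩ ?_
      (fun k => φ k b) (fun k l hkl => ?_) fun k => ?_)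
    · have : DefPred L M fun p : A × A => ∀ v, (∃ c, c ∈ I ∧ c * p.1 = v) ↔
          ∃ c, c ∈ I ∧ c * p.2 = v := .all <| .iff
        (.ex (.and (hIpred.comp (by fun_prop)) (.eq (by fun_prop) (by fun_prop))))
        (.ex (.and (hIpred.comp (by fun_prop)) (.eq (by fun_prop) (by fun_prop))))
      exact this.congr fun p => SetLike.ext_iff
    · by_contra hne
      rcases lt_or_gt_of_ne hne with hlt | hlt
      · exact hdistinct k l hlt hkl
      · exact hdistinct l k hlt hkl.symm
    · refine (hCrk.image (hφdef k) hIpred (hφinj k) fun a ha => (hCS ha).1).mono ?_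
      rintro _ ⟨a, ha, rfl⟩
      refine ⟨hφI k a (hCS ha).1, SetLike.ext fun v => ?_⟩
      rw [hφim, hφim, hCim b hbC a ha]


end Minimal

/-- Every nonzero left ideal of a definable semiprime ring contains a minimal left ideal. -/
theorem Semiprime.exists_minLeft (L : FirstOrder.Language) (M : Type) [L.Structure M]
    {A : Type} [NonUnitalRing A] [DefType L M A] [RingDef L M A] [LinearOrder M]
    [TameStructure L M] [DenselyOrdered M] [NoMinOrder M] [NoMaxOrder M] (hsp : Semiprime A)
    {B : AddSubgroup A}
    (hB : ∀ r, ∀ x ∈ B, r * x ∈ B) (hne : B ≠ ⊥) : ∃ I ≤ B, MinLeft I := by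
  classical
  have hle : ∀ y ∈ B, leftMul y ≤ B := by
    rintro y hy _ ⟨r, rfl⟩
    exact hB r y hy
  have hex : ∃ d, ∃ x ∈ B, x ≠ 0 ∧ ¬ RkGE L M (d + 1) (leftMul x : Set A) := by
    obtain ⟨x, hx, hx0⟩ := B.bot_or_exists_ne_zero.resolve_left hne
    obtain ⟨k, hk⟩ := exists_rkGE_le L M A
    exact ⟨k, x, hx, hx0, fun h => absurd (hk _ _ h) (by omega)⟩
  obtain ⟨x, hx, hx0, hd⟩ := Nat.find_spec hex
  rcases hcase : Nat.find hex with _ | m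
  · rw [hcase] at hd
    obtain ⟨I, hI, hmin⟩ := hsp.exists_minLeft_of_finite hx0
      (Set.not_infinite.1 (mt rkGE_one.2 hd))
    exact ⟨I, hI.trans (hle x hx), hmin⟩
  · rw [hcase] at hd
    have hall : ∀ y ∈ B, y ≠ 0 → RkGE L M (m + 1) (leftMul y : Set A) := by
      intro y hy hy0
      by_contra hlt
      exact Nat.find_min hex (hcase ▸ Nat.lt_succ_self m) ⟨y, hy, hy0, hlt⟩
    obtain ⟨I, hI, hmin⟩ := hsp.exists_minLeft_of_rank hx0 hd fun y hy hy0 =>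
      hall y (hle x hx hy) hy0
    exact ⟨I, hI.trans (hle x hx), hmin⟩


section Decomposition

theorem Semiprime.finite_rightMul {A : Type} [NonUnitalRing A] (hsp : Semiprime A) {x : A}
    (hx : (leftMul x : Set A).Finite) : (Set.range (x * ·)).Finite := by
  have := hx.to_subtype
  let ψ (a : Set.range (x * ·)) (y : leftMul x) : leftMul x := ⟨a * y, leftMul_mul_mem y.2 _⟩
  have hψ : Function.Injective ψ := by
    rintro ⟨_, r, rfl⟩ ⟨_, s, rfl⟩ h
    refine Subtype.ext (sub_eq_zero.1 (hsp _ fun t => ?_))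
    have ht := congrArg Subtype.val (congrFun h ⟨t * x, mul_mem_leftMul t x⟩)
    replace ht : x * r * (t * x) = x * s * (t * x) := ht
    have hz : (x * r - x * s) * (t * x) = 0 := by rw [sub_mul, ht, sub_self]
    change (x * r - x * s) * t * (x * r - x * s) = 0
    rw [← mul_sub x r s] at hz ⊢
    rw [← mul_assoc, mul_assoc _ t x, hz, zero_mul]
  have := Finite.of_injective ψ hψ
  exact Set.toFinite _

/-- The elements generating a finite left ideal. -/
def finitePart (A : Type) [NonUnitalRing A] : AddSubgroup A where
  carrier := {x | (leftMul x : Set A).Finite}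
  zero_mem' := (Set.finite_singleton 0).subset (by
    rintro _ ⟨r, rfl⟩
    exact mul_zero r)
  add_mem' {x y} hx hy := (hx.add hy).subset (by
    rintro _ ⟨r, rfl⟩
    exact ⟨r * x, mul_mem_leftMul r x, r * y, mul_mem_leftMul r y, (mul_add r x y).symm⟩)
  neg_mem' {x} hx := hx.subset (by
    rintro _ ⟨r, rfl⟩
    exact ⟨-r, neg_mul_comm r x⟩)

theorem mem_finitePart {A : Type} [NonUnitalRing A] {x : A} :
    x ∈ finitePart A ↔ (leftMul x : Set A).Finite := Iff.rfl

theorem finitePart_of_mem_leftMul {A : Type} [NonUnitalRing A] {x y : A} (hx : x ∈ finitePart A)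
    (hy : y ∈ leftMul x) : y ∈ finitePart A :=
  Set.Finite.subset hx (leftMul_le hy)

theorem finitePart_mul {A : Type} [NonUnitalRing A] {x : A} (hx : x ∈ finitePart A) (b : A) :
    x * b ∈ finitePart A := by
  refine (Set.Finite.image (· * b) hx).subset ?_
  rintro _ ⟨r, rfl⟩
  exact ⟨r * x, mul_mem_leftMul r x, mul_assoc r x b⟩

/-- Adjoining to an idempotent `e` the part of an idempotent `g` orthogonal to `e`. -/
theorem orthogonalize {A : Type} [NonUnitalRing A] {e g : A} (he : e * e = e) (hg : g * g = g)
    (hge : g * e = 0) : g * (g - e * g) = g ∧ (g - e * g) * (g - e * g) = g - e * g ∧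
      e * (g - e * g) = 0 ∧ (g - e * g) * e = 0 := by
  have h₁ : g * (g - e * g) = g := by rw [mul_sub, hg, ← mul_assoc, hge, zero_mul, sub_zero]
  refine ⟨h₁, ?_, ?_, ?_⟩
  · rw [sub_mul, h₁, mul_assoc, h₁]
  · rw [mul_sub, ← mul_assoc, he, sub_self]
  · rw [sub_mul, hge, mul_assoc, hge, mul_zero, sub_zero]

theorem Semiprime.exists_idempotent
    (L : FirstOrder.Language) (M : Type) [L.Structure M] {A : Type} [NonUnitalRing A]
    [DefType L M A] [RingDef L M A] [LinearOrder M] [TameStructure L M] [DenselyOrdered M]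
    [NoMinOrder M] [NoMaxOrder M] (hsp : Semiprime A) {B : AddSubgroup A}
    (hB : ∀ r, ∀ x ∈ B, r * x ∈ B) (hne : B ≠ ⊥) :
    ∃ g ∈ B, g * g = g ∧ g ≠ 0 ∧ MinLeft (leftMul g) := by
  obtain ⟨I, hIB, hI⟩ := hsp.exists_minLeft L M hB hne
  obtain ⟨g, hgI, hg, hg0, rfl⟩ := hI.exists_idempotent hsp
  exact ⟨g, hIB hgI, hg, hg0, hI⟩

theorem Semiprime.exists_right_unit
    (L : FirstOrder.Language) (M : Type) [L.Structure M] {A : Type} [NonUnitalRing A]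
    [DefType L M A] [RingDef L M A] [LinearOrder M] [TameStructure L M] [DenselyOrdered M]
    [NoMinOrder M] [NoMaxOrder M] (hsp : Semiprime A) {x : A} (hx : x ∈ finitePart A) :
    ∃ v ∈ finitePart A, x * v = x := by
  suffices ∀ (k : ℕ) (e : A), e ∈ finitePart A → e * e = e →
      (leftMul (x - x * e) : Set A).ncard = k → ∃ v ∈ finitePart A, x * v = x from
    this _ 0 (finitePart A).zero_mem (mul_zero 0) rfl
  intro k
  induction k using Nat.strong_induction_on with
  | _ k ih =>
    intro e heF he hk
    by_cases hw0 : x - x * e = 0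
    · exact ⟨e, heF, (sub_eq_zero.1 hw0).symm⟩
    set w := x - x * e with hw
    have hwF : w ∈ finitePart A := (finitePart A).sub_mem hx (finitePart_mul hx e)
    have hwe : w * e = 0 := by rw [hw, sub_mul, mul_assoc, he, sub_self]
    obtain ⟨g, hgw, hg, hg0, -⟩ := Semiprime.exists_idempotent L M hsp
      (fun r y hy => leftMul_mul_mem hy r) (hsp.leftMul_ne_bot hw0)
    have hge : g * e = 0 := by
      obtain ⟨r, rfl⟩ := hgw
      change r * w * e = 0
      rw [mul_assoc, hwe, mul_zero]
    have hgF : g ∈ finitePart A := finitePart_of_mem_leftMul hwF hgw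
    obtain ⟨hgf, hff, hef, hfe⟩ := orthogonalize he hg hge
    set f := g - e * g
    have hfF : f ∈ finitePart A := (finitePart A).sub_mem hgF (finitePart_mul heF g)
    have hwf : x - x * (e + f) = w - w * f := by
      rw [hw, sub_mul, mul_assoc, hef, mul_zero, sub_zero, mul_add, sub_sub]
    refine ih _ ?_ (e + f) ((finitePart A).add_mem heF hfF) ?_ rfl
    · rw [hwf, ← hk]
      have hsub : (leftMul (w - w * f) : Set A) ⊆
          (fun y => y - y * f) '' ((leftMul w : Set A) \ {g}) := by
        rintro _ ⟨r, rfl⟩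
        change r * (w - w * f) ∈ _
        by_cases hrg : r * w = g
        · refine ⟨0, ⟨(leftMul w).zero_mem, fun h => hg0 h.symm⟩, ?_⟩
          rw [mul_sub, ← mul_assoc, hrg, hgf]
          simp
        · exact ⟨r * w, ⟨mul_mem_leftMul r w, hrg⟩, by simp only [mul_sub, mul_assoc]⟩
      calc (leftMul (w - w * f) : Set A).ncard
          ≤ ((fun y => y - y * f) '' ((leftMul w : Set A) \ {g})).ncard :=
            Set.ncard_le_ncard hsub ((Set.Finite.sdiff hwF).image _)
        _ ≤ ((leftMul w : Set A) \ {g}).ncard := Set.ncard_image_le (Set.Finite.sdiff hwF)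
        _ < (leftMul w : Set A).ncard := Set.ncard_sdiff_singleton_lt_of_mem hgw hwF
    · rw [add_mul, mul_add, mul_add, he, hef, hfe, hff, add_zero, zero_add]

theorem Semiprime.finite_finitePart
    (L : FirstOrder.Language) (M : Type) [L.Structure M] {A : Type} [NonUnitalRing A]
    [DefType L M A] [RingDef L M A] [LinearOrder M] [TameStructure L M] [DenselyOrdered M]
    [NoMinOrder M] [NoMaxOrder M] (hsp : Semiprime A) : (finitePart A : Set A).Finite := by
  classical
  have hFpred : DefPred L M fun x => x ∈ finitePart A := by
    refine (DefPred.not (DefPred.rkGE 1 (s := fun x : A => (leftMul x : Set A))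
      (.mem_leftMul (by fun_prop) (by fun_prop)))).congr fun x => ?_
    rw [rkGE_one, Set.not_infinite]
    exact mem_finitePart
  obtain ⟨k, hk⟩ := exists_rkGE_le L M A
  have hex : ∃ n, ¬ RkGE L M (n + 1) (finitePart A : Set A) :=
    ⟨k, fun h => absurd (hk _ _ h) (by omega)⟩
  obtain ⟨f, hf⟩ : ∃ f, RkGE L M f (finitePart A : Set A) ∧
      ¬ RkGE L M (f + 1) (finitePart A : Set A) := by
    refine ⟨Nat.find hex, ?_, Nat.find_spec hex⟩
    rcases hcase : Nat.find hex with _ | m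
    · exact ⟨0, (finitePart A).zero_mem⟩
    · exact not_not.1 (Nat.find_min hex (hcase ▸ Nat.lt_succ_self m))
  let Z : Set (A × A) := {p | (p.1 ∈ finitePart A ∧ p.2 ∈ finitePart A) ∧
    ∃ v, (v ∈ finitePart A ∧ p.1 * v = p.1) ∧ p.2 * v = 0}
  have hZpred : DefPred L M fun p => p ∈ Z := .and
    (.and (hFpred.comp (by fun_prop)) (hFpred.comp (by fun_prop))) <|
    .ex (P := fun (p : A × A) v => (v ∈ finitePart A ∧ p.1 * v = p.1) ∧ p.2 * v = 0) <|
    .and (.and (hFpred.comp (by fun_prop)) (.eq (by fun_prop) (by fun_prop)))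
      (.eq (by fun_prop) (by fun_prop))
  have hZrk : RkGE L M (f + f) Z := by
    refine RkGE.add (f := Prod.fst) DefMap.fst' hf.1 fun x hx => ?_
    obtain ⟨v, hv, hxv⟩ := Semiprime.exists_right_unit L M hsp hx
    have hker : RkGE L M f {y | y ∈ finitePart A ∧ y * v = 0} := by
      refine hf.1.ker v (Set.Finite.subset hv ?_)
      rintro _ ⟨y, -, rfl⟩
      exact mul_mem_leftMul y v
    refine (hker.image_injective (f := fun y => (x, y)) (by fun_prop)
      fun y y' h => congrArg Prod.snd h).mono ?_
    rintro _ ⟨y, hy, rfl⟩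
    exact ⟨⟨⟨hx, hy.1⟩, v, ⟨hv, hxv⟩, hy.2⟩, rfl⟩
  have hfib : ∀ s, (Z ∩ (fun p : A × A => p.1 + p.2) ⁻¹' {s}).Finite := by
    intro s
    by_cases hs : s ∈ finitePart A
    · refine ((hsp.finite_rightMul hs).image fun x => (x, s - x)).subset ?_
      rintro ⟨x, y⟩ ⟨⟨-, v, ⟨-, hxv⟩, hyv⟩, hxy⟩
      replace hxy : x + y = s := hxy
      replace hxv : x * v = x := hxv
      replace hyv : y * v = 0 := hyv
      refine ⟨x, ⟨v, ?_⟩, ?_⟩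
      · change s * v = x
        rw [← hxy, add_mul, hxv, hyv, add_zero]
      · change (x, s - x) = (x, y)
        rw [← hxy, add_sub_cancel_left]
    · convert Set.finite_empty
      refine Set.eq_empty_of_forall_notMem ?_
      rintro ⟨x, y⟩ ⟨⟨⟨hx, hy⟩, -⟩, hxy⟩
      exact hs (hxy ▸ (finitePart A).add_mem hx hy)
  obtain ⟨d, e, hde, h⟩ := hZrk.exists_fibre hZpred (g := fun p : A × A => p.1 + p.2) (by fun_prop)
  obtain ⟨s, hs⟩ := h.nonempty
  obtain rfl : d = 0 := by
    by_contra hd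
    exact rkGE_one.1 (RkGE.of_le hs (by omega : 1 ≤ d)) (hfib s)
  have he : RkGE L M e (finitePart A : Set A) := by
    refine h.mono fun s hs => ?_
    obtain ⟨p, hp, rfl⟩ := RkGE.nonempty hs
    exact (finitePart A).add_mem hp.1.1 hp.1.2
  have hf0 : f = 0 := by
    by_contra hne
    exact hf.2 (he.of_le (by omega))
  subst hf0
  exact Set.not_infinite.1 (mt rkGE_one.2 hf.2)

/-- `B` is the direct sum of minimal left ideals generated by idempotents of `B`. -/
def HasDecomp {A : Type} [NonUnitalRing A] (B : AddSubgroup A) : Prop :=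
  ∃ (n : ℕ) (g : Fin n → A),
    (∀ i, (g i ∈ B ∧ g i * g i = g i ∧ g i ≠ 0) ∧ MinLeft (leftMul (g i))) ∧
    (∀ x ∈ B, ∃ c : Fin n → A, (∀ i, c i ∈ leftMul (g i)) ∧ ∑ i, c i = x) ∧
    ∀ c c' : Fin n → A, (∀ i, c i ∈ leftMul (g i)) → (∀ i, c' i ∈ leftMul (g i)) →
      ∑ i, c i = ∑ i, c' i → c = c'

/-- The left annihilator of `e`. -/
def annih {A : Type} [NonUnitalRing A] (e : A) : AddSubgroup A := (AddMonoidHom.mulRight e).ker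

theorem mem_annih {A : Type} [NonUnitalRing A] {e x : A} : x ∈ annih e ↔ x * e = 0 := Iff.rfl

theorem mul_mem_annih {A : Type} [NonUnitalRing A] {e x : A} (h : x ∈ annih e) (r : A) :
    r * x ∈ annih e := by
  rw [mem_annih, mul_assoc, mem_annih.1 h, mul_zero]

theorem mem_annih_add {A : Type} [NonUnitalRing A] {e f x : A} (he : e * e = e)
    (hfe : f * e = 0) (hef : e * f = 0)
    (hf : f * f = f) : x ∈ annih (e + f) ↔ x ∈ annih e ∧ x * f = 0 := by
  simp only [mem_annih]
  constructor
  · intro h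
    constructor
    · calc x * e = x * (e + f) * e := by rw [mul_assoc, add_mul, he, hfe, add_zero]
        _ = 0 := by rw [h, zero_mul]
    · calc x * f = x * (e + f) * f := by rw [mul_assoc, add_mul, hf, hef, zero_add]
        _ = 0 := by rw [h, zero_mul]
  · rintro ⟨h, h'⟩
    rw [mul_add, h, h', add_zero]

theorem HasDecomp.of_annih_add {A : Type} [NonUnitalRing A] {e f : A} (he : e * e = e)
    (hfe : f * e = 0) (hef : e * f = 0)
    (hf : f * f = f) (hf0 : f ≠ 0) (hmin : MinLeft (leftMul f)) (h : HasDecomp (annih (e + f))) :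
    HasDecomp (annih e) := by
  obtain ⟨n, g, hg, hex, huniq⟩ := h
  have hcf : ∀ c ∈ leftMul f, c * f = c := by
    rintro _ ⟨r, rfl⟩
    exact (mul_assoc r f f).trans (congrArg (r * ·) hf)
  have hsum : ∀ c : Fin n → A, (∀ i, c i ∈ leftMul (g i)) → (∑ i, c i) * f = 0 := by
    intro c hc
    rw [Finset.sum_mul]
    refine Finset.sum_eq_zero fun i _ => ?_
    obtain ⟨r, hr⟩ := hc i
    exact hr ▸ ((mem_annih_add he hfe hef hf).1 (mul_mem_annih (hg i).1.1 r)).2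
  refine ⟨n + 1, Fin.cons f g, fun i => ?_, fun x hx => ?_, fun c c' hc hc' hcc => ?_⟩
  · refine Fin.cases ⟨⟨hfe, hf, hf0⟩, hmin⟩ (fun i => ?_) i
    exact ⟨⟨((mem_annih_add he hfe hef hf).1 (hg i).1.1).1, (hg i).1.2⟩, (hg i).2⟩
  · obtain ⟨c, hc, hcx⟩ := hex (x - x * f) <| (mem_annih_add he hfe hef hf).2
      ⟨(annih e).sub_mem hx (by rw [mem_annih, mul_assoc, hfe, mul_zero]),
        by rw [sub_mul, mul_assoc, hf, sub_self]⟩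
    refine ⟨Fin.cons (x * f) c, fun i => Fin.cases ⟨x, rfl⟩ hc i, ?_⟩
    rw [Fin.sum_univ_succ]
    simp [hcx]
  · have h0 : c 0 = c' 0 := by
      have := congrArg (· * f) hcc
      simp only [Fin.sum_univ_succ, add_mul] at this
      rwa [hsum _ fun i => hc i.succ, hsum _ fun i => hc' i.succ, add_zero, add_zero,
        hcf _ (hc 0), hcf _ (hc' 0)] at this
    have hs : (fun i : Fin n => c i.succ) = fun i => c' i.succ := by
      refine huniq _ _ (fun i => hc i.succ) (fun i => hc' i.succ) ?_
      rw [Fin.sum_univ_succ, Fin.sum_univ_succ, h0] at hcc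
      exact add_left_cancel hcc
    exact funext (Fin.cases h0 fun i => congrFun hs i)

theorem Semiprime.hasDecomp_annih
    (L : FirstOrder.Language) (M : Type) [L.Structure M] {A : Type} [NonUnitalRing A]
    [DefType L M A] [RingDef L M A] [LinearOrder M] [TameStructure L M] [DenselyOrdered M]
    [NoMinOrder M] [NoMaxOrder M] (hsp : Semiprime A) (d N : ℕ) (e : A) (he : e * e = e)
    (hd : ¬ RkGE L M d (annih e : Set A))
    (hN : ((annih e : Set A) ∩ finitePart A).ncard ≤ N) : HasDecomp (annih e) := by
  induction d generalizing N e with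
  | zero => exact absurd ⟨0, (annih e).zero_mem⟩ hd
  | succ d ihd =>
    induction N using Nat.strong_induction_on generalizing e with
    | _ N ihN =>
      by_cases hbot : annih e = ⊥
      · refine ⟨0, Fin.elim0, fun i => i.elim0, fun x hx => ⟨Fin.elim0, fun i => i.elim0, ?_⟩,
          fun c c' _ _ _ => funext fun i => i.elim0⟩
        rw [hbot, AddSubgroup.mem_bot] at hx
        simp [hx]
      obtain ⟨g, hge, hg, hg0, hmin⟩ := Semiprime.exists_idempotent L M hsp
        (fun r y hy => mul_mem_annih hy r) hbot
      obtain ⟨hgf, hff, hef, hfe⟩ := orthogonalize he hg hge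
      set f := g - e * g
      have hf0 : f ≠ 0 := by
        intro h
        rw [h, mul_zero] at hgf
        exact hg0 hgf.symm
      have hfg : leftMul f = leftMul g := by
        have hfg : f ∈ leftMul g := by
          refine (leftMul g).sub_mem ⟨g, hg⟩ (mul_mem_leftMul e g)
        exact le_antisymm (leftMul_le hfg) (hmin.2.2 f hfg hf0)
      have he' : (e + f) * (e + f) = e + f := by
        rw [add_mul, mul_add, mul_add, he, hef, hfe, hff, add_zero, zero_add]
      refine HasDecomp.of_annih_add he hfe hef hff hf0 (hfg ▸ hmin) ?_
      have hann := fun x => mem_annih_add (x := x) he hfe hef hff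
      by_cases hfin : (leftMul f : Set A).Finite
      · refine ihN _ (lt_of_lt_of_le (Set.ncard_lt_ncard ?_ ?_) hN) (e + f) he'
          (fun h => hd (h.mono fun x hx => ((hann x).1 hx).1)) le_rfl
        · refine ⟨fun x hx => ⟨((hann x).1 hx.1).1, hx.2⟩, fun h => hf0 ?_⟩
          exact hff ▸ ((hann f).1 (h ⟨hfe, mem_finitePart.2 hfin⟩).1).2
        · exact (Semiprime.finite_finitePart L M hsp).inter_of_right _
      · refine ihd _ (e + f) he' (fun h => hfin ?_) le_rfl
        refine (finite_image_of_ker (I := annih e) f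
          (h.mono fun x hx => (hann x).1 hx) hd).subset ?_
        rintro _ ⟨r, rfl⟩
        refine ⟨r * f, ?_, ?_⟩
        · exact mul_mem_annih (mem_annih.2 hfe) r
        · exact (mul_assoc r f f).trans (congrArg (r * ·) hff)

theorem Semiprime.exists_decomp
    (L : FirstOrder.Language) (M : Type) [L.Structure M] {A : Type} [NonUnitalRing A]
    [DefType L M A] [RingDef L M A] [LinearOrder M] [TameStructure L M] [DenselyOrdered M]
    [NoMinOrder M] [NoMaxOrder M] (hsp : Semiprime A) : HasDecomp (⊤ : AddSubgroup A) := by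
  obtain ⟨k, hk⟩ := exists_rkGE_le L M A
  have h := Semiprime.hasDecomp_annih L M hsp (k + 1) _ 0 (mul_zero 0)
    (fun h => absurd (hk _ _ h) (by omega)) le_rfl
  convert h
  exact (AddSubgroup.ext fun x => by simp [mem_annih])

end Decomposition

section Transfer

theorem Semiprime.of_ideals {A : Type} [NonUnitalRing A]
    (h : ∀ I : AddSubgroup A, (∀ r, ∀ x ∈ I, r * x ∈ I ∧ x * r ∈ I) →
      (∀ x ∈ I, ∀ y ∈ I, ∀ z ∈ I, x * (y * z) = 0) → I = ⊥) : Semiprime A := by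
  intro a ha
  let T : AddSubgroup A :=
    { carrier := {x | ∀ r s, r * x * s = 0}
      zero_mem' := fun r s => by rw [mul_zero, zero_mul]
      add_mem' := fun {x y} hx hy r s => by rw [mul_add, add_mul, hx, hy, add_zero]
      neg_mem' := fun {x} hx r s => by rw [mul_neg, neg_mul, hx, neg_zero] }
  have hT : T = ⊥ := h T
    (fun r x hx => ⟨fun s t => by rw [← mul_assoc]; exact hx _ _,
      fun s t => by rw [← mul_assoc, mul_assoc]; exact hx _ _⟩)
    fun x _ y hy z _ => (mul_assoc x y z).symm.trans (hy x z)
  let S : Set A := {x | ∃ r s, r * a * s = x}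
  have hS : AddSubgroup.closure S = ⊥ := by
    refine h _ (fun r x hx => ?_) fun x hx y hy z _ => ?_
    · induction hx using AddSubgroup.closure_induction with
      | mem x hx =>
        obtain ⟨s, t, rfl⟩ := hx
        exact ⟨AddSubgroup.subset_closure ⟨r * s, t, by simp only [mul_assoc]⟩,
          AddSubgroup.subset_closure ⟨s, t * r, by simp only [mul_assoc]⟩⟩
      | zero => simp
      | add x y _ _ hx hy =>
        rw [mul_add, add_mul]
        exact ⟨AddSubgroup.add_mem _ hx.1 hy.1, AddSubgroup.add_mem _ hx.2 hy.2⟩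
      | neg x _ hx =>
        rw [mul_neg, neg_mul]
        exact ⟨AddSubgroup.neg_mem _ hx.1, AddSubgroup.neg_mem _ hx.2⟩
    · rw [← mul_assoc]
      suffices x * y = 0 by rw [this, zero_mul]
      induction hx, hy using AddSubgroup.closure_induction₂ with
      | mem x y hx hy =>
        obtain ⟨r, s, rfl⟩ := hx
        obtain ⟨t, u, rfl⟩ := hy
        calc r * a * s * (t * a * u) = r * (a * (s * t) * a) * u := by simp only [mul_assoc]
          _ = 0 := by rw [ha, mul_zero, zero_mul]
      | zero_left => exact zero_mul _
      | zero_right => exact mul_zero _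
      | add_left x y z _ _ _ hx hy => rw [add_mul, hx, hy, add_zero]
      | add_right x y z _ _ _ hx hy => rw [mul_add, hx, hy, add_zero]
      | neg_left x y _ _ hx => rw [neg_mul, hx, neg_zero]
      | neg_right x y _ _ hx => rw [mul_neg, hx, neg_zero]
  have haT : a ∈ T := fun r s => by
    have : r * a * s ∈ AddSubgroup.closure S := AddSubgroup.subset_closure ⟨r, s, rfl⟩
    rwa [hS, AddSubgroup.mem_bot] at this
  rwa [hT, AddSubgroup.mem_bot] at haT

namespace DefRing

variable {L : FirstOrder.Language} {M : Type} [L.Structure M] (R : DefRing L M)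

/-- The ring structure on the carrier of a definable ring. -/
instance carrierRing : NonUnitalRing ↥R.carrier where
  add a b := ⟨R.add a b, R.add_mem _ a.2 _ b.2⟩
  add_assoc a b c := Subtype.ext (R.hadd_assoc _ a.2 _ b.2 _ c.2)
  zero := ⟨R.zero, R.zero_mem⟩
  zero_add a := Subtype.ext (R.hzero_add _ a.2)
  add_zero a := Subtype.ext (add_zero' a.2)
  add_comm a b := Subtype.ext (R.hadd_comm _ a.2 _ b.2)
  neg a := ⟨R.neg a, R.neg_mem _ a.2⟩
  neg_add_cancel a := Subtype.ext (R.hneg_add _ a.2)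
  nsmul := @nsmulRec _ ⟨⟨R.zero, R.zero_mem⟩⟩ ⟨fun a b => ⟨R.add a b, R.add_mem _ a.2 _ b.2⟩⟩
  zsmul := @zsmulRec _ ⟨⟨R.zero, R.zero_mem⟩⟩ ⟨fun a b => ⟨R.add a b, R.add_mem _ a.2 _ b.2⟩⟩
    ⟨fun a => ⟨R.neg a, R.neg_mem _ a.2⟩⟩
    (@nsmulRec _ ⟨⟨R.zero, R.zero_mem⟩⟩ ⟨fun a b => ⟨R.add a b, R.add_mem _ a.2 _ b.2⟩⟩)
  mul a b := ⟨R.mul a b, R.mul_mem _ a.2 _ b.2⟩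
  mul_assoc a b c := Subtype.ext (R.hmul_assoc _ a.2 _ b.2 _ c.2)
  left_distrib a b c := Subtype.ext (R.hleft_distrib _ a.2 _ b.2 _ c.2)
  right_distrib a b c := Subtype.ext (R.hright_distrib _ a.2 _ b.2 _ c.2)
  zero_mul a := Subtype.ext (zero_mul' a.2)
  mul_zero a := Subtype.ext (mul_zero' a.2)

instance carrierDefType : DefType L M ↥R.carrier where
  ι := Fin R.k
  finite_ι := inferInstance
  emb := Subtype.val
  emb_injective := Subtype.val_injective
  range_def := by
    rw [Subtype.range_val]
    exact R.carrier_def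

instance carrierRingDef : RingDef L M ↥R.carrier where
  add_def := by
    refine ⟨_, R.add_def.preimage_comp
      (Sum.elim (Sum.inl ∘ Sum.inl) (Sum.elim (Sum.inl ∘ Sum.inr) Sum.inr)), ?_⟩
    rintro ⟨⟨a, b⟩, c⟩
    exact Subtype.ext_iff.trans ⟨fun h => ⟨a.2, b.2, h⟩, fun h => h.2.2⟩
  mul_def := by
    refine ⟨_, R.mul_def.preimage_comp
      (Sum.elim (Sum.inl ∘ Sum.inl) (Sum.elim (Sum.inl ∘ Sum.inr) Sum.inr)), ?_⟩
    rintro ⟨⟨a, b⟩, c⟩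
    exact Subtype.ext_iff.trans ⟨fun h => ⟨a.2, b.2, h⟩, fun h => h.2.2⟩

variable {R}

theorem isSubgroup_image (I : AddSubgroup ↥R.carrier) :
    R.IsSubgroup (Subtype.val '' (I : Set ↥R.carrier)) := by
  refine ⟨?_, ⟨0, I.zero_mem, rfl⟩, ?_, ?_⟩
  · rintro _ ⟨x, -, rfl⟩
    exact x.2
  · rintro _ ⟨x, hx, rfl⟩ _ ⟨y, hy, rfl⟩
    exact ⟨x + y, I.add_mem hx hy, rfl⟩
  · rintro _ ⟨x, hx, rfl⟩
    exact ⟨-x, I.neg_mem hx, rfl⟩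

theorem IsSemiprime.semiprime (h : R.IsSemiprime) : Semiprime ↥R.carrier := by
  refine Semiprime.of_ideals fun I hI hI3 => ?_
  have h0 := h (Subtype.val '' (I : Set ↥R.carrier)) ⟨isSubgroup_image I, ?_⟩ ⟨3, by omega, ?_⟩
  · refine (AddSubgroup.eq_bot_iff_forall I).2 fun x hx => Subtype.ext ?_
    have : (x : Fin R.k → M) ∈ Subtype.val '' (I : Set ↥R.carrier) := ⟨x, hx, rfl⟩
    rwa [h0] at this
  · rintro r hr _ ⟨x, hx, rfl⟩
    have := hI ⟨r, hr⟩ x hx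
    exact ⟨⟨_, this.1, rfl⟩, ⟨_, this.2, rfl⟩⟩
  · refine Set.Subset.antisymm ?_ ?_
    · rintro _ ⟨_, ⟨x, hx, rfl⟩, _, ⟨_, ⟨y, hy, rfl⟩, _, ⟨z, hz, rfl⟩, rfl⟩, rfl⟩
      exact congrArg Subtype.val (hI3 x hx y hy z hz)
    · rintro _ rfl
      have hz := I.zero_mem
      exact ⟨_, ⟨0, hz, rfl⟩, _, ⟨_, ⟨0, hz, rfl⟩, _, ⟨0, hz, rfl⟩, rfl⟩,
        congrArg Subtype.val (hI3 0 hz 0 hz 0 hz).symm⟩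

theorem univSum_coe {ι : Type} [Fintype ι] (c : ι → ↥R.carrier) :
    R.univSum (fun i => (c i : Fin R.k → M)) = ↑(∑ i, c i) := by
  rw [← Finset.sum_map_toList]
  change R.listSum _ = _
  induction (Finset.univ : Finset ι).toList with
  | nil => rfl
  | cons i l ih =>
    rw [List.map_cons, List.map_cons, List.sum_cons]
    exact congrArg (R.add (c i)) ih

theorem leftMulSet_coe (e : ↥R.carrier) :
    R.leftMulSet e = Subtype.val '' (leftMul e : Set ↥R.carrier) := by
  ext z
  constructor
  · rintro ⟨r, hr, rfl⟩
    exact ⟨_, mul_mem_leftMul ⟨r, hr⟩ e, rfl⟩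
  · rintro ⟨_, ⟨r, rfl⟩, rfl⟩
    exact ⟨r, r.2, rfl⟩

theorem isMinimalLeftIdeal {I : AddSubgroup ↥R.carrier} (hI : MinLeft I) :
    R.IsMinimalLeftIdeal (Subtype.val '' (I : Set ↥R.carrier)) := by
  obtain ⟨hne, hleft, hmin⟩ := hI
  refine ⟨⟨isSubgroup_image I, ?_⟩, fun h => hne ?_, fun J hJ hJI => ?_⟩
  · rintro r hr _ ⟨x, hx, rfl⟩
    exact ⟨_, hleft ⟨r, hr⟩ x hx, rfl⟩
  · refine (AddSubgroup.eq_bot_iff_forall I).2 fun x hx => Subtype.ext ?_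
    have : (x : Fin R.k → M) ∈ Subtype.val '' (I : Set ↥R.carrier) := ⟨x, hx, rfl⟩
    rwa [h] at this
  · by_cases hex : ∃ y ∈ J, y ≠ R.zero
    · refine Or.inr (hJI.antisymm ?_)
      obtain ⟨y, hyJ, hy0⟩ := hex
      obtain ⟨y, hyI, rfl⟩ := hJI hyJ
      rintro _ ⟨x, hx, rfl⟩
      obtain ⟨r, rfl⟩ := hmin y hyI (fun h => hy0 (congrArg Subtype.val h)) hx
      exact hJ.2 r r.2 y hyJ
    · push Not at hex
      exact Or.inl (Set.Subset.antisymm hex (Set.singleton_subset_iff.2 hJ.1.2.1))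

theorem isPrimitiveIdempotent {e : ↥R.carrier} (he : e * e = e) (he0 : e ≠ 0)
    (hmin : MinLeft (leftMul e)) : R.IsPrimitiveIdempotent e := by
  refine ⟨⟨e.2, congrArg Subtype.val he⟩, fun h => he0 (Subtype.ext h), ?_⟩
  rintro ⟨a, b, ⟨ha, haa⟩, ⟨hb, -⟩, ha0, hb0, ⟨hab, hba⟩, heq⟩
  exact hb0 <| congrArg Subtype.val <| hmin.primitive (f := ⟨a, ha⟩) (g := ⟨b, hb⟩) he
    (Subtype.ext haa) (fun h => ha0 (congrArg Subtype.val h)) (Subtype.ext hab)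
    (Subtype.ext hba) (Subtype.ext heq.symm)

end DefRing

end Transfer
end OMin
namespace OMin

/-- A definably connected definable semiprime ring is either a
division ring, or possesses finitely many primitive idempotents `e₁, …, e_n` with
`R = R·e₁ ⊕ ⋯ ⊕ R·e_n` as additive groups, each `R·eᵢ` being a minimal left ideal. -/
theorem statement_19 {L : FirstOrder.Language} {M : Type} [L.Structure M] [LinearOrder M]
    (hM : OMinimal L M) (R : DefRing L M) (hconn : DefConnected L M R.carrier)
    (hsp : R.IsSemiprime) :
    R.IsDivisionRing ∨
      ∃ (n : ℕ) (e : Fin n → (Fin R.k → M)),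
        (∀ i, R.IsPrimitiveIdempotent (e i)) ∧
        R.IsInternalDirectSum (fun i => R.leftMulSet (e i)) ∧
        ∀ i, R.IsMinimalLeftIdeal (R.leftMulSet (e i)) := by
  have := hM.tameStructure
  have := hM.1
  have := hM.2.1
  have := hM.2.2.1
  obtain ⟨n, g, hg, hex, huniq⟩ := Semiprime.exists_decomp L M hsp.semiprime
  refine Or.inr ⟨n, fun i => g i,
    fun i => DefRing.isPrimitiveIdempotent (hg i).1.2.1 (hg i).1.2.2 (hg i).2, ?_, fun i => ?_⟩
  · simp only [DefRing.leftMulSet_coe]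
    refine ⟨fun i => ?_, fun x hx => ?_, fun f f' hf hf' hff' => ?_⟩
    · exact ⟨DefRing.isSubgroup_image _, (DefRing.isSubgroup_image _).1⟩
    · obtain ⟨c, hc, hcx⟩ := hex ⟨x, hx⟩ (AddSubgroup.mem_top _)
      refine ⟨fun i => c i, fun i => ⟨c i, hc i, rfl⟩, ?_⟩
      rw [DefRing.univSum_coe, hcx]
    · choose c hc hcf using hf
      choose c' hc' hcf' using hf'
      obtain rfl : (fun i => (c i : Fin R.k → M)) = f := funext hcf
      obtain rfl : (fun i => (c' i : Fin R.k → M)) = f' := funext hcf'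
      rw [DefRing.univSum_coe, DefRing.univSum_coe] at hff'
      rw [huniq c c' hc hc' (Subtype.ext hff')]
  · rw [DefRing.leftMulSet_coe]
    exact DefRing.isMinimalLeftIdeal (hg i).2

end OMin
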